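/- arXiv:2004.02159 — 9 statements merged into one kernel-verified Lean document; each statement's English description precedes it below -/
import Mathlib

section
/- Let G be a finite bipartite simple graph with bipartition (A,B), and write its graph polynomial as P_G = ∏_{ab ∈ E(G)} (X_a − X_b), where in each factor a ∈ A and b ∈ B. Then for every function d : V(G) → ℕ, the coefficient in P_G of the monomial ∏_{v ∈ V(G)} X_v^{d(v)} equals (−1)^{Σ_{b ∈ B} d(b)} times the number of orientations of G whose indegree function equals d. In particular, for every orientation D of G the monomial ∏_{v ∈ V(G)} X_v^{indeg_D(v)} has nonzero coefficient in P_G. -/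
open MvPolynomial Finset

/-- An orientation of `G` assigns to each edge one of its two endpoints (its head). -/
@[reducible] def GraphOrientation {V : Type*} [Fintype V] [DecidableEq V]
    (G : SimpleGraph V) [DecidableRel G.Adj] : Type _ :=
  ∀ e : G.edgeFinset, {v : V // v ∈ (e : Sym2 V)}

/-- The indegree of a vertex `v` is the number of edges whose head is `v`. -/
def indeg {V : Type*} [Fintype V] [DecidableEq V]
    (G : SimpleGraph V) [DecidableRel G.Adj] (o : GraphOrientation G) (v : V) : ℕ :=
  (univ.filter (fun e : G.edgeFinset => (o e : V) = v)).card

/-- The graph polynomial of a bipartite graph `G` with bipartition classes `A` and `Aᶜ`: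
the product over edges `ab` (with `a ∈ A`, `b ∉ A`) of the factors `(X_a - X_b)`. -/
noncomputable def bipGraphPoly {V : Type*} [Fintype V] [DecidableEq V]
    (G : SimpleGraph V) [DecidableRel G.Adj] (A : Finset V) : MvPolynomial V ℝ :=
  ∏ p ∈ univ.filter (fun p : V × V => G.Adj p.1 p.2 ∧ p.1 ∈ A ∧ p.2 ∉ A),
    (X p.1 - X p.2)

/-- The sign with which `X_v` occurs in the factors of the graph polynomial. -/
noncomputable def bipSign {V : Type*} [DecidableEq V] (A : Finset V) (v : V) : ℝ :=
  if v ∈ A then 1 else -1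

theorem bipGraphPoly_eq_prod_edges {V : Type*} [Fintype V] [DecidableEq V]
    (G : SimpleGraph V) [DecidableRel G.Adj] (A : Finset V)
    (hbip : ∀ ⦃u v : V⦄, G.Adj u v → (u ∈ A ↔ v ∉ A)) :
    bipGraphPoly G A = ∏ e : G.edgeFinset, ∑ v : {v : V // v ∈ (e : Sym2 V)},
      monomial (Finsupp.single (v : V) 1) (bipSign A v) := by
  rw [bipGraphPoly, Finset.prod_coe_sort G.edgeFinset (fun e : Sym2 V =>
    ∑ v : {v : V // v ∈ e}, monomial (Finsupp.single (v : V) 1) (bipSign A v))]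
  refine Finset.prod_bij (fun p _ => s(p.1, p.2)) ?_ ?_ ?_ ?_
  · intro p hp
    simpa using (mem_filter.1 hp).2.1
  · rintro ⟨a, b⟩ hp ⟨c, d⟩ hq h
    simp only [mem_filter, mem_univ, true_and] at hp hq
    rcases Sym2.eq_iff.1 h with ⟨rfl, rfl⟩ | ⟨rfl, rfl⟩
    · rfl
    · exact absurd hp.2.1 hq.2.2
  · intro e he
    induction e using Sym2.ind with
    | _ a b =>
      have hab : G.Adj a b := by simpa using he
      by_cases ha : a ∈ A
      · exact ⟨(a, b), by simp [hab, ha, (hbip hab).1 ha], rfl⟩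
      · have hb : b ∈ A := (hbip hab.symm).2 ha
        exact ⟨(b, a), by simp [hab.symm, ha, hb], Sym2.eq_swap⟩
  · rintro ⟨a, b⟩ hp
    simp only [mem_filter, mem_univ, true_and] at hp
    rw [← Finset.sum_subtype ({a, b} : Finset V) (fun v => by simp)
      (fun v => monomial (Finsupp.single v 1) (bipSign A v)),
      Finset.sum_pair hp.1.ne]
    simp [bipSign, hp.2.1, hp.2.2, X, sub_eq_add_neg]

theorem sum_single_head_eq_indeg {V : Type*} [Fintype V] [DecidableEq V]
    (G : SimpleGraph V) [DecidableRel G.Adj] (o : GraphOrientation G) :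
    ∑ e : G.edgeFinset, Finsupp.single (o e : V) 1 =
      Finsupp.equivFunOnFinite.symm (indeg G o) := by
  ext v
  simp [Finsupp.finsetSum_apply, Finsupp.single_apply, indeg]

theorem prod_bipSign_head {V : Type*} [Fintype V] [DecidableEq V]
    (G : SimpleGraph V) [DecidableRel G.Adj] (A : Finset V) (o : GraphOrientation G) :
    ∏ e : G.edgeFinset, bipSign A (o e) = (-1 : ℝ) ^ (∑ b ∈ Aᶜ, indeg G o b) := by
  rw [← Finset.prod_fiberwise univ (fun e : G.edgeFinset => (o e : V)),
    ← Finset.prod_pow_eq_pow_sum, ← Finset.prod_subset (Finset.subset_univ Aᶜ)]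
  · refine Finset.prod_congr rfl fun b hb => ?_
    rw [indeg, ← Finset.prod_const]
    refine Finset.prod_congr rfl fun e he => ?_
    simp [bipSign, (mem_filter.1 he).2, mem_compl.1 hb]
  · intro a _ ha
    refine Finset.prod_eq_one fun e he => ?_
    simp [bipSign, (mem_filter.1 he).2, show a ∈ A by simpa using ha]

theorem bipGraphPoly_eq_sum_orientations {V : Type*} [Fintype V] [DecidableEq V]
    (G : SimpleGraph V) [DecidableRel G.Adj] (A : Finset V)
    (hbip : ∀ ⦃u v : V⦄, G.Adj u v → (u ∈ A ↔ v ∉ A)) :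
    bipGraphPoly G A = ∑ o : GraphOrientation G,
      monomial (Finsupp.equivFunOnFinite.symm (indeg G o))
        ((-1 : ℝ) ^ (∑ b ∈ Aᶜ, indeg G o b)) := by
  rw [bipGraphPoly_eq_prod_edges G A hbip, Finset.prod_univ_sum, Fintype.piFinset_univ]
  refine Finset.sum_congr rfl fun o _ => ?_
  rw [← sum_single_head_eq_indeg, ← prod_bipSign_head, monomial_sum_prod]

theorem coeff_bipGraphPoly {V : Type*} [Fintype V] [DecidableEq V]
    (G : SimpleGraph V) [DecidableRel G.Adj] (A : Finset V)
    (hbip : ∀ ⦃u v : V⦄, G.Adj u v → (u ∈ A ↔ v ∉ A)) (d : V → ℕ) :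
    coeff (Finsupp.equivFunOnFinite.symm d) (bipGraphPoly G A) =
      (-1 : ℝ) ^ (∑ b ∈ Aᶜ, d b) *
        (Nat.card {o : GraphOrientation G // ∀ v, indeg G o v = d v} : ℝ) := by
  classical
  rw [bipGraphPoly_eq_sum_orientations G A hbip, coeff_sum, Nat.card_eq_fintype_card,
    Fintype.card_subtype, Finset.card_filter, Nat.cast_sum, Finset.mul_sum]
  refine Finset.sum_congr rfl fun o _ => ?_
  rw [coeff_monomial]
  simp only [EmbeddingLike.apply_eq_iff_eq, funext_iff]
  split_ifs with h
  · simp [h]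
  · simp

/-- For a finite bipartite simple graph `G` with bipartition `(A, Aᶜ)` and any
`d : V → ℕ`, the coefficient in `P_G` of `∏ v, X_v ^ d v` equals
`(-1) ^ (∑_{b ∈ Aᶜ} d b)` times the number of orientations of `G` whose indegree
function is `d`.  In particular, for every orientation the monomial given by its
indegrees has nonzero coefficient in `P_G`. -/
theorem bipartite_graphPoly_coeff {V : Type*} [Fintype V] [DecidableEq V]
    (G : SimpleGraph V) [DecidableRel G.Adj] (A : Finset V)
    (hbip : ∀ ⦃u v : V⦄, G.Adj u v → (u ∈ A ↔ v ∉ A)) :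
    (∀ d : V → ℕ,
      MvPolynomial.coeff (Finsupp.equivFunOnFinite.symm d) (bipGraphPoly G A) =
        (-1 : ℝ) ^ (∑ b ∈ Aᶜ, d b) *
          (Nat.card {o : GraphOrientation G // ∀ v, indeg G o v = d v} : ℝ)) ∧
    (∀ o : GraphOrientation G,
      MvPolynomial.coeff (Finsupp.equivFunOnFinite.symm (fun v => indeg G o v))
        (bipGraphPoly G A) ≠ 0) := by
  refine ⟨coeff_bipGraphPoly G A hbip, fun o => ?_⟩
  rw [coeff_bipGraphPoly G A hbip]
  have : Nonempty {o' : GraphOrientation G // ∀ v, indeg G o' v = indeg G o v} :=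
    ⟨⟨o, fun _ => rfl⟩⟩
  exact mul_ne_zero (pow_ne_zero _ (by norm_num)) (Nat.cast_ne_zero.2 Nat.card_pos.ne')
end

section
/- A finite simple graph has at most one acyclic orientation with a given indegree sequence: if D₁ and D₂ are acyclic orientations of a finite simple graph G such that indeg_{D₁}(v) = indeg_{D₂}(v) for every vertex v, then D₁ = D₂ (they assign the same head to every edge). -/
open Finset

/-- The directed-edge relation of an orientation: `u → v` when `uv` is an edge of `G`
whose head is `v`. -/
def orientRel {V : Type*} [Fintype V] [DecidableEq V]
    (G : SimpleGraph V) [DecidableRel G.Adj] (o : GraphOrientation G) (u v : V) : Prop :=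
  ∃ h : G.Adj u v,
    (o ⟨s(u, v), SimpleGraph.mem_edgeFinset.mpr ((SimpleGraph.mem_edgeSet G).mpr h)⟩ : V) = v

/-- An orientation is acyclic if the resulting directed graph has no directed cycle. -/
def AcyclicOrientation {V : Type*} [Fintype V] [DecidableEq V]
    (G : SimpleGraph V) [DecidableRel G.Adj] (o : GraphOrientation G) : Prop :=
  ∀ v : V, ¬ Relation.TransGen (orientRel G o) v v

section

variable {V : Type*} [Fintype V] [DecidableEq V] {G : SimpleGraph V} [DecidableRel G.Adj]

/-- The reverse of an acyclic orientation is well-founded. -/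
theorem AcyclicOrientation.wellFounded_swap_transGen {o : GraphOrientation G}
    (ho : AcyclicOrientation G o) :
    WellFounded (Function.swap (Relation.TransGen (orientRel G o))) :=
  haveI : Std.Irrefl (Function.swap (Relation.TransGen (orientRel G o))) := ⟨ho⟩
  haveI : IsTrans V (Function.swap (Relation.TransGen (orientRel G o))) :=
    ⟨fun _ _ _ hab hbc => hbc.trans hab⟩
  Finite.wellFounded_of_trans_of_irrefl _

/-- The directed-edge relation at an edge, whichever way its endpoints are listed. -/
theorem orientRel_iff_head_eq {o : GraphOrientation G} {u v : V} {e : G.edgeFinset}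
    (he : (e : Sym2 V) = s(u, v)) : orientRel G o u v ↔ (o e : V) = v := by
  obtain ⟨e, hmem⟩ := e
  subst he
  exact ⟨fun ⟨_, h⟩ => h, fun h => ⟨by simpa using hmem, h⟩⟩

/-- An edge with head `v` under `o` but not under `o'` joins some `w` to `v`, with `o` directing
it from `w` to `v` and `o'` from `v` to `w`. -/
theorem exists_orientRel_of_head_ne {o o' : GraphOrientation G} {v : V} {e : G.edgeFinset}
    (he : (o e : V) = v) (he' : (o' e : V) ≠ v) :
    ∃ w, orientRel G o w v ∧ orientRel G o' v w := by
  obtain ⟨w, hw⟩ := Sym2.mem_iff_exists.mp (he ▸ (o e).2)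
  have hmem : (o' e : V) ∈ s(v, w) := hw.subst (motive := fun z => (o' e : V) ∈ z) (o' e).2
  exact ⟨w, (orientRel_iff_head_eq (hw.trans Sym2.eq_swap)).mpr he,
    (orientRel_iff_head_eq hw).mpr ((Sym2.mem_iff.mp hmem).resolve_left he')⟩

/-- If two orientations have the same indegree at `v` and some edge has head `v` only under the
first, then some edge has head `v` only under the second. -/
theorem exists_head_ne_of_indeg_eq {o o' : GraphOrientation G} {v : V}
    (h : indeg G o v = indeg G o' v) {e : G.edgeFinset}
    (he : (o e : V) = v) (he' : (o' e : V) ≠ v) :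
    ∃ f : G.edgeFinset, (o' f : V) = v ∧ (o f : V) ≠ v := by
  by_contra! hsub
  have heq := eq_of_subset_of_card_le
    (monotone_filter_right univ fun f _ => hsub f) h.le
  have hmem : e ∈ univ.filter fun f : G.edgeFinset => (o' f : V) = v := by
    rw [heq]; simpa using he
  exact he' (by simpa using hmem)

/-- An acyclic orientation has the same head at every edge as any orientation with the same
indegrees. -/
theorem AcyclicOrientation.eq_of_indeg_eq {o o' : GraphOrientation G}
    (ho : AcyclicOrientation G o) (h : ∀ v, indeg G o v = indeg G o' v) : o = o' := by
  have key : ∀ v, ∀ e : G.edgeFinset, (o e : V) = v → (o' e : V) = v := by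
    intro v
    induction v using ho.wellFounded_swap_transGen.induction with
    | _ v ih =>
      intro e he
      by_contra he'
      obtain ⟨f, hf', hf⟩ := exists_head_ne_of_indeg_eq (h v) he he'
      obtain ⟨w, hwv, hadj, hvw⟩ := exists_orientRel_of_head_ne hf' hf
      exact hadj.ne (((orientRel_iff_head_eq Sym2.eq_swap).mp hwv).symm.trans
        (ih w (.single ⟨hadj, hvw⟩) _ hvw))
  funext e
  exact Subtype.ext (key _ e rfl).symm

end

/-- A finite simple graph has at most one acyclic orientation with a given indegree
sequence: two acyclic orientations with the same indegree at every vertex assign the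
same head to every edge. -/
theorem acyclicOrientation_unique_of_indeg {V : Type*} [Fintype V] [DecidableEq V]
    (G : SimpleGraph V) [DecidableRel G.Adj]
    (o₁ o₂ : GraphOrientation G)
    (h₁ : AcyclicOrientation G o₁) (h₂ : AcyclicOrientation G o₂)
    (h : ∀ v, indeg G o₁ v = indeg G o₂ v) : o₁ = o₂ := by
  exact h₁.eq_of_indeg_eq h
end

section
/- Let G be a finite simple graph on vertices v₁,…,vₙ that admits an acyclic orientation with indegree sequence (d₁,…,dₙ), i.e., indeg(v_i) = d_i for each i. Then the coefficient of the monomial X₁^{d₁} X₂^{d₂} ⋯ Xₙ^{dₙ} in the graph polynomial P_G equals 1 or −1; in particular, this monomial is non-vanishing in P_G. -/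
open MvPolynomial Finset

/-- The graph polynomial of `G`: the product, over edges `v_i v_j` of `G` with
`v_i < v_j`, of the factors `(X_i - X_j)`. -/
noncomputable def graphPoly {V : Type*} [Fintype V] [LinearOrder V]
    (G : SimpleGraph V) [DecidableRel G.Adj] : MvPolynomial V ℝ :=
  ∏ p ∈ univ.filter (fun p : V × V => G.Adj p.1 p.2 ∧ p.1 < p.2),
    (X p.1 - X p.2)

theorem coeff_prod_X_sub_X {R V ι : Type*} [CommRing R] (s : Finset ι) (head tail : ι → V)
    (w : V → ℕ) (hw : ∀ i ∈ s, w (tail i) < w (head i)) :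
    MvPolynomial.coeff (∑ i ∈ s, Finsupp.single (head i) 1)
      (∏ i ∈ s, (X (head i) - X (tail i) : MvPolynomial V R)) = 1 := by
  classical
  simp_rw [sub_eq_add_neg, Finset.prod_add]
  have hmon (t : Finset ι) (f : ι → V) :
      ∏ i ∈ t, (X (f i) : MvPolynomial V R) = monomial (∑ i ∈ t, Finsupp.single (f i) 1) 1 := by
    rw [monomial_sum_one]
    rfl
  rw [coeff_sum, Finset.sum_eq_single s]
  · simp [hmon]
  · intro t ht hts
    have hts' : t ⊆ s := Finset.mem_powerset.mp ht
    have hne : (s \ t).Nonempty :=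
      Finset.sdiff_nonempty.mpr fun h ↦ hts (hts'.antisymm h)
    have hprod : (∏ i ∈ t, (X (head i) : MvPolynomial V R)) * ∏ i ∈ s \ t, -X (tail i) =
        C ((-1) ^ (s \ t).card) * monomial (∑ i ∈ t, Finsupp.single (head i) 1 +
          ∑ i ∈ s \ t, Finsupp.single (tail i) 1) 1 := by
      rw [Finset.prod_neg, hmon, hmon, mul_left_comm, monomial_mul, one_mul]
      simp
    rw [hprod, coeff_C_mul, coeff_monomial, if_neg, mul_zero]
    intro h
    have h' := congrArg (Finsupp.weight w) h
    simp only [map_add, map_sum, Finsupp.weight_single, one_smul,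
      ← Finset.sum_sdiff hts'] at h'
    have hlt := Finset.sum_lt_sum_of_nonempty hne
      fun i hi ↦ hw i (Finset.mem_sdiff.mp hi).1
    omega
  · simp

theorem prod_eq_or_eq_neg {R ι : Type*} [CommRing R] (s : Finset ι) (f g : ι → R)
    (h : ∀ i ∈ s, f i = g i ∨ f i = -g i) :
    ∏ i ∈ s, f i = ∏ i ∈ s, g i ∨ ∏ i ∈ s, f i = -∏ i ∈ s, g i := by
  classical
  induction s using Finset.induction_on with
  | empty => simp
  | insert a s ha ih =>
    rw [Finset.prod_insert ha, Finset.prod_insert ha]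
    rcases h a (by simp) with h₁ | h₁ <;>
    rcases ih fun i hi ↦ h i (by simp [hi]) with h₂ | h₂ <;>
    simp [h₁, h₂]

theorem exists_nat_strictMono_of_acyclic {V : Type*} [Finite V] (r : V → V → Prop)
    (hr : ∀ v, ¬ Relation.TransGen r v v) : ∃ w : V → ℕ, ∀ u v, r u v → w u < w v := by
  refine ⟨fun v ↦ {u | Relation.TransGen r u v}.ncard, fun u v huv ↦ ?_⟩
  refine Set.ncard_lt_ncard (Set.ssubset_iff_of_subset ?_ |>.mpr ⟨u, .single huv, hr u⟩)
    (Set.toFinite _)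
  exact fun x hx ↦ Relation.TransGen.tail hx huv

theorem orientRel_swap_of_not {V : Type*} [Fintype V] [DecidableEq V]
    {G : SimpleGraph V} [DecidableRel G.Adj] {o : GraphOrientation G} {u v : V}
    (h : G.Adj u v) (hn : ¬ orientRel G o u v) : orientRel G o v u := by
  have hmem := (o ⟨s(u, v), SimpleGraph.mem_edgeFinset.mpr h⟩).2
  rcases Sym2.mem_iff.mp hmem with hu | hv
  · refine ⟨h.symm, ?_⟩
    have he : (⟨s(v, u), SimpleGraph.mem_edgeFinset.mpr h.symm⟩ : G.edgeFinset) =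
        ⟨s(u, v), SimpleGraph.mem_edgeFinset.mpr h⟩ := Subtype.ext Sym2.eq_swap
    rw [he]
    exact hu
  · exact absurd ⟨h, hv⟩ hn

open Classical in
/-- The head of the edge joining the two entries of `p`. -/
noncomputable def edgeHead {V : Type*} [Fintype V] [DecidableEq V]
    (G : SimpleGraph V) [DecidableRel G.Adj] (o : GraphOrientation G) (p : V × V) : V :=
  if orientRel G o p.1 p.2 then p.2 else p.1

open Classical in
/-- The tail of the edge joining the two entries of `p`. -/
noncomputable def edgeTail {V : Type*} [Fintype V] [DecidableEq V]
    (G : SimpleGraph V) [DecidableRel G.Adj] (o : GraphOrientation G) (p : V × V) : V :=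
  if orientRel G o p.1 p.2 then p.1 else p.2

theorem orientRel_edgeTail_edgeHead {V : Type*} [Fintype V] [DecidableEq V]
    {G : SimpleGraph V} [DecidableRel G.Adj] (o : GraphOrientation G) {p : V × V}
    (h : G.Adj p.1 p.2) : orientRel G o (edgeTail G o p) (edgeHead G o p) := by
  unfold edgeTail edgeHead
  split_ifs with hp
  · exact hp
  · exact orientRel_swap_of_not h hp

theorem coe_orientation_eq_edgeHead {V : Type*} [Fintype V] [DecidableEq V]
    {G : SimpleGraph V} [DecidableRel G.Adj] (o : GraphOrientation G) {p : V × V}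
    (h : G.Adj p.1 p.2) :
    (o ⟨s(p.1, p.2), SimpleGraph.mem_edgeFinset.mpr h⟩ : V) = edgeHead G o p := by
  unfold edgeHead
  split_ifs with hp
  · exact hp.2
  · have hmem := (o ⟨s(p.1, p.2), SimpleGraph.mem_edgeFinset.mpr h⟩).2
    exact (Sym2.mem_iff.mp hmem).resolve_right fun hv ↦ hp ⟨h, hv⟩

theorem indeg_eq_card_edgeHead {V : Type*} [Fintype V] [LinearOrder V]
    (G : SimpleGraph V) [DecidableRel G.Adj] (o : GraphOrientation G) (v : V) :
    indeg G o v = ((univ.filter fun p : V × V ↦ G.Adj p.1 p.2 ∧ p.1 < p.2).filter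
      fun p ↦ edgeHead G o p = v).card := by
  symm
  refine Finset.card_bij (fun p hp ↦ ⟨s(p.1, p.2), SimpleGraph.mem_edgeFinset.mpr
    (Finset.mem_filter.mp (Finset.mem_filter.mp hp).1).2.1⟩) ?_ ?_ ?_
  · intro p hp
    simp only [mem_filter, mem_univ, true_and] at hp ⊢
    rw [coe_orientation_eq_edgeHead o hp.1.1, hp.2]
  · rintro ⟨a, b⟩ hp ⟨c, e⟩ hq h
    simp only [mem_filter, mem_univ, true_and] at hp hq
    rcases Sym2.eq_iff.mp (congrArg Subtype.val h) with ⟨h₁, h₂⟩ | ⟨h₁, h₂⟩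
    · exact Prod.ext h₁ h₂
    · exact absurd ((hp.1.2.trans_eq h₂).trans (hq.1.2.trans_eq h₁.symm)) (lt_irrefl _)
  · rintro ⟨e, he⟩ hev
    simp only [mem_filter, mem_univ, true_and] at hev
    induction e using Sym2.ind with
    | _ a b =>
      have hab : G.Adj a b := SimpleGraph.mem_edgeFinset.mp he
      rcases hab.ne.lt_or_gt with hlt | hlt
      · refine ⟨(a, b), ?_, rfl⟩
        simp only [mem_filter, mem_univ, true_and]
        exact ⟨⟨hab, hlt⟩, (coe_orientation_eq_edgeHead o (p := (a, b)) hab).symm.trans hev⟩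
      · have hs : (⟨s(b, a), SimpleGraph.mem_edgeFinset.mpr hab.symm⟩ : G.edgeFinset) =
            ⟨s(a, b), he⟩ := Subtype.ext Sym2.eq_swap
        refine ⟨(b, a), ?_, hs⟩
        simp only [mem_filter, mem_univ, true_and]
        refine ⟨⟨hab.symm, hlt⟩, ?_⟩
        rw [← coe_orientation_eq_edgeHead o (p := (b, a)) hab.symm, hs, hev]

/-- If a finite simple graph `G` admits an acyclic orientation with indegree sequence
`d`, then the coefficient of the monomial `∏ v, X_v ^ d v` in the graph polynomial
`P_G` equals `1` or `-1`; in particular this monomial is non-vanishing in `P_G`. -/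
theorem coeff_graphPoly_of_acyclicOrientation {V : Type*} [Fintype V] [LinearOrder V]
    (G : SimpleGraph V) [DecidableRel G.Adj]
    (o : GraphOrientation G) (ho : AcyclicOrientation G o)
    (d : V → ℕ) (hd : ∀ v, indeg G o v = d v) :
    MvPolynomial.coeff (Finsupp.equivFunOnFinite.symm d) (graphPoly G) = 1 ∨
      MvPolynomial.coeff (Finsupp.equivFunOnFinite.symm d) (graphPoly G) = -1 := by
  obtain ⟨w, hw⟩ := exists_nat_strictMono_of_acyclic (orientRel G o) ho
  have hexp : Finsupp.equivFunOnFinite.symm d =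
      ∑ p ∈ univ.filter (fun p : V × V => G.Adj p.1 p.2 ∧ p.1 < p.2),
        Finsupp.single (edgeHead G o p) 1 := by
    ext v
    rw [Finsupp.finsetSum_apply, Finsupp.equivFunOnFinite_symm_apply_apply, ← hd,
      indeg_eq_card_edgeHead, Finset.card_filter]
    simp only [Finsupp.single_apply]
  have hcoeff := coeff_prod_X_sub_X (R := ℝ)
    (univ.filter fun p : V × V => G.Adj p.1 p.2 ∧ p.1 < p.2) (edgeHead G o) (edgeTail G o) w
    fun p hp ↦ hw _ _ (orientRel_edgeTail_edgeHead o (Finset.mem_filter.mp hp).2.1)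
  have hsign := prod_eq_or_eq_neg (univ.filter fun p : V × V => G.Adj p.1 p.2 ∧ p.1 < p.2)
    (fun p ↦ (X p.1 - X p.2 : MvPolynomial V ℝ))
    (fun p ↦ X (edgeHead G o p) - X (edgeTail G o p)) fun p _ ↦ by
      unfold edgeHead edgeTail
      split_ifs <;> simp
  rw [graphPoly, hexp]
  rcases hsign with h | h
  · exact .inl (by rw [h, hcoeff])
  · exact .inr (by rw [h, coeff_neg, hcoeff])
end

section
/- Let G be a finite simple graph whose vertex set is partitioned as V(G) = X ⊔ Y, let G[X] and G[Y] be the induced subgraphs, and for y ∈ Y let b(y) denote the number of neighbors of y in X. Suppose M₁ is a monomial in the variables indexed by X whose coefficient c₁ in the graph polynomial P_{G[X]} is nonzero, and M₂ is a monomial in the variables indexed by Y whose coefficient c₂ in P_{G[Y]} is nonzero. Then the monomial M₁ · M₂ · ∏_{y ∈ Y} X_y^{b(y)} has coefficient ±c₁c₂ in the graph polynomial P_G; in particular this coefficient is nonzero. -/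
open MvPolynomial Finset

/-- The graph polynomial of the induced subgraph `G[s]`, taken in the
corresponding subset of variables (with the inherited vertex ordering). -/
noncomputable def graphPolyOn {V : Type*} [Fintype V] [LinearOrder V]
    (G : SimpleGraph V) [DecidableRel G.Adj] (s : Finset V) : MvPolynomial V ℝ :=
  ∏ p ∈ univ.filter (fun p : V × V => G.Adj p.1 p.2 ∧ p.1 < p.2 ∧ p.1 ∈ s ∧ p.2 ∈ s),
    (X p.1 - X p.2)

/-- The monomials of a polynomial in `supported ℝ s` only involve the variables in `s`. -/
theorem eq_zero_of_coeff_ne_zero_of_mem_supported {σ : Type*} {s : Set σ} {P : MvPolynomial σ ℝ}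
    (hP : P ∈ supported ℝ s) {n : σ →₀ ℕ} (hn : coeff n P ≠ 0) {v : σ} (hv : v ∉ s) : n v = 0 := by
  classical
  by_contra h
  exact hv (mem_supported.1 hP (mem_coe.2
    ((mem_vars_iff_mem_support v).2 ⟨n, mem_support_iff.2 hn, Finsupp.mem_support_iff.2 h⟩)))

/-- Coefficients of a product of two polynomials in disjoint sets of variables. -/
theorem coeff_add_mul_of_mem_supported {σ : Type*} {s t : Set σ} (hst : Disjoint s t)
    {P Q : MvPolynomial σ ℝ} (hP : P ∈ supported ℝ s) (hQ : Q ∈ supported ℝ t) {m n : σ →₀ ℕ}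
    (hm : ∀ v ∉ s, m v = 0) (hn : ∀ v ∉ t, n v = 0) :
    coeff (m + n) (P * Q) = coeff m P * coeff n Q := by
  classical
  rw [coeff_mul]
  refine Finset.sum_eq_single_of_mem (m, n) (by simp) ?_
  rintro ⟨k, l⟩ hkl hne
  by_contra h
  obtain ⟨hk, hl⟩ : coeff k P ≠ 0 ∧ coeff l Q ≠ 0 := mul_ne_zero_iff.1 h
  rw [HasAntidiagonal.mem_antidiagonal] at hkl
  have key : ∀ v, k v = m v ∧ l v = n v := by
    intro v
    have hv : k v + l v = m v + n v := DFunLike.congr_fun hkl v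
    by_cases hs : v ∈ s
    · have ht : v ∉ t := Set.disjoint_left.1 hst hs
      have := eq_zero_of_coeff_ne_zero_of_mem_supported hQ hl ht
      have := hn v ht
      omega
    · have := eq_zero_of_coeff_ne_zero_of_mem_supported hP hk hs
      have := hm v hs
      omega
  exact hne (Prod.ext (Finsupp.ext fun v => (key v).1) (Finsupp.ext fun v => (key v).2))

/-- The exponents of a nonzero monomial of `P * X v` come from those of `P`. -/
theorem exists_coeff_ne_zero_of_mul_X {σ : Type*} {P : MvPolynomial σ ℝ} {v : σ} {n : σ →₀ ℕ}
    (h : coeff n (P * X v) ≠ 0) : ∃ k, coeff k P ≠ 0 ∧ n = k + Finsupp.single v 1 := by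
  classical
  rw [coeff_mul_X'] at h
  split_ifs at h with hv
  · refine ⟨_, h, (tsub_add_cancel_of_le ?_).symm⟩
    rw [Finsupp.single_le_iff]
    exact Nat.one_le_iff_ne_zero.2 (Finsupp.mem_support_iff.1 hv)
  · exact absurd rfl h

/-- If `m` has maximal degree in the variables of `B` among the monomials of `Q`, then multiplying
`Q` by linear factors, each involving one variable in `B` and one outside `B`, and adding to `m`
the variables in `B` of these factors changes the coefficient only by a sign. -/
theorem exists_sign_coeff_mul_prod_X_sub_X {σ : Type*} [DecidableEq σ] (B : Finset σ)
    (s : Finset (σ × σ)) (hs : ∀ p ∈ s, (p.1 ∈ B ↔ p.2 ∉ B)) :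
    ∃ ε : ℝ, (ε = 1 ∨ ε = -1) ∧ ∀ (Q : MvPolynomial σ ℝ) (m : σ →₀ ℕ),
      (∀ n, coeff n Q ≠ 0 → ∑ v ∈ B, n v ≤ ∑ v ∈ B, m v) →
      coeff (m + ∑ p ∈ s, Finsupp.single (if p.1 ∈ B then p.1 else p.2) 1)
        (Q * ∏ p ∈ s, (X p.1 - X p.2)) = ε * coeff m Q := by
  induction s using Finset.induction_on with
  | empty => exact ⟨1, Or.inl rfl, by simp⟩
  | insert p s hp ih =>
    obtain ⟨ε, hε, ih⟩ := ih fun q hq => hs q (mem_insert_of_mem hq)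
    have hsum : ∀ (k : σ →₀ ℕ) (v : σ), ∑ u ∈ B, (k + Finsupp.single v 1 : σ →₀ ℕ) u =
        ∑ u ∈ B, k u + if v ∈ B then 1 else 0 := by
      intro k v
      simp [Finset.sum_add_distrib, Finsupp.single_apply]
    have bound : ∀ (Q : MvPolynomial σ ℝ) (m : σ →₀ ℕ) (b : σ), b ∈ B →
        (∀ n, coeff n Q ≠ 0 → ∑ v ∈ B, n v ≤ ∑ v ∈ B, m v) →
        ∀ n, coeff n (Q * (X p.1 - X p.2)) ≠ 0 →
          ∑ v ∈ B, n v ≤ ∑ v ∈ B, (m + Finsupp.single b 1 : σ →₀ ℕ) v := by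
      intro Q m b hb hQ n hn
      have hor : coeff n (Q * X p.1) ≠ 0 ∨ coeff n (Q * X p.2) ≠ 0 := by
        by_contra! h
        exact hn (by rw [mul_sub, coeff_sub, h.1, h.2, sub_zero])
      rw [hsum, if_pos hb]
      rcases hor with h | h <;>
      · obtain ⟨k, hk, rfl⟩ := exists_coeff_ne_zero_of_mul_X h
        have := hQ k hk
        rw [hsum]
        split_ifs <;> omega
    have top : ∀ (Q : MvPolynomial σ ℝ) (m : σ →₀ ℕ) (a b : σ), a ∉ B → b ∈ B →
        (∀ n, coeff n Q ≠ 0 → ∑ v ∈ B, n v ≤ ∑ v ∈ B, m v) →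
        coeff (m + Finsupp.single b 1) (Q * X a) = 0 := by
      intro Q m a b ha hb hQ
      by_contra h
      obtain ⟨k, hk, hmk⟩ := exists_coeff_ne_zero_of_mul_X h
      have h₁ := hQ k hk
      have h₂ := hsum m b
      rw [hmk, hsum, if_neg ha, if_pos hb] at h₂
      omega
    have hpB := hs p (mem_insert_self p s)
    by_cases h₁ : p.1 ∈ B
    · refine ⟨ε, hε, fun Q m hQ => ?_⟩
      rw [prod_insert hp, sum_insert hp, ← mul_assoc, ← add_assoc, if_pos h₁,
        ih _ _ (bound Q m _ h₁ hQ), mul_sub, coeff_sub, top Q m _ _ (hpB.1 h₁) h₁ hQ,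
        coeff_mul_X, sub_zero]
    · have h₂ : p.2 ∈ B := by tauto
      refine ⟨-ε, by rcases hε with rfl | rfl <;> simp, fun Q m hQ => ?_⟩
      rw [prod_insert hp, sum_insert hp, ← mul_assoc, ← add_assoc, if_neg h₁,
        ih _ _ (bound Q m _ h₂ hQ), mul_sub, coeff_sub, top Q m _ _ h₁ h₂ hQ,
        coeff_mul_X, zero_sub, mul_neg, neg_mul]

theorem graphPolyOn_mem_supported {V : Type*} [Fintype V] [LinearOrder V]
    (G : SimpleGraph V) [DecidableRel G.Adj] (s : Finset V) :
    graphPolyOn G s ∈ supported ℝ (s : Set V) := by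
  refine Subalgebra.prod_mem _ fun p hp => ?_
  simp only [mem_filter, mem_univ, true_and] at hp
  exact Subalgebra.sub_mem _ (X_mem_supported.2 hp.2.2.1) (X_mem_supported.2 hp.2.2.2)

theorem exists_isHomogeneous_graphPolyOn {V : Type*} [Fintype V] [LinearOrder V]
    (G : SimpleGraph V) [DecidableRel G.Adj] (s : Finset V) :
    ∃ d, (graphPolyOn G s).IsHomogeneous d :=
  ⟨_, IsHomogeneous.prod _ _ (fun _ => 1) fun p _ =>
    (isHomogeneous_X ℝ p.1).sub (isHomogeneous_X ℝ p.2)⟩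

/-- The edges of `G` between `B` and its complement, oriented increasingly. -/
def crossEdges {V : Type*} [Fintype V] [LinearOrder V]
    (G : SimpleGraph V) [DecidableRel G.Adj] (B : Finset V) : Finset (V × V) :=
  univ.filter fun p => G.Adj p.1 p.2 ∧ p.1 < p.2 ∧ (p.1 ∈ B ↔ p.2 ∉ B)

theorem graphPoly_eq_mul_prod_crossEdges {V : Type*} [Fintype V] [LinearOrder V]
    (G : SimpleGraph V) [DecidableRel G.Adj] {A B : Finset V} (h : ∀ v, v ∈ A ↔ v ∉ B) :
    graphPoly G =
      graphPolyOn G A * graphPolyOn G B * ∏ p ∈ crossEdges G B, (X p.1 - X p.2) := by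
  unfold graphPoly graphPolyOn crossEdges
  rw [← prod_union, ← prod_union]
  · congr 1
    ext p
    simp only [mem_union, mem_filter, mem_univ, true_and, h]
    tauto
  · simp only [disjoint_left, mem_union, mem_filter, mem_univ, true_and, h]
    tauto
  · simp only [disjoint_left, mem_filter, mem_univ, true_and, h]
    tauto

theorem sum_crossEdges_single {V : Type*} [Fintype V] [LinearOrder V]
    (G : SimpleGraph V) [DecidableRel G.Adj] {A B : Finset V} (h : ∀ v, v ∈ A ↔ v ∉ B) :
    ∑ p ∈ crossEdges G B, Finsupp.single (if p.1 ∈ B then p.1 else p.2) 1 =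
      Finsupp.equivFunOnFinite.symm
        (fun v => if v ∈ B then (A.filter (fun x => G.Adj v x)).card else 0) := by
  ext v
  simp only [Finsupp.finsetSum_apply, Finsupp.single_apply,
    Finsupp.equivFunOnFinite_symm_apply_apply, ← card_filter]
  split_ifs with hv
  · refine card_nbij' (fun p => if p.1 ∈ B then p.2 else p.1)
      (fun a => if v < a then (v, a) else (a, v)) ?_ ?_ ?_ ?_
    · intro p hp
      simp only [crossEdges, coe_filter, mem_filter, mem_univ, true_and, Set.mem_ofPred_eq,
        h] at hp ⊢
      have := hp.1.1.symm
      grind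
    · intro a ha
      simp only [crossEdges, coe_filter, mem_filter, mem_univ, true_and, Set.mem_ofPred_eq,
        h] at ha ⊢
      have := ha.2.symm
      have := ha.2.ne
      grind
    · intro p hp
      simp only [crossEdges, coe_filter, mem_filter, mem_univ, true_and, Set.mem_ofPred_eq] at hp
      grind
    · intro a ha
      simp only [coe_filter, Set.mem_ofPred_eq, h] at ha
      grind
  · rw [card_eq_zero, filter_eq_empty_iff]
    intro p hp
    simp only [crossEdges, mem_filter, mem_univ, true_and] at hp
    grind

/-- Let the vertex set of `G` be partitioned as `A ⊔ B`, and for `y ∈ B` let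
`b y` be the number of neighbors of `y` in `A`.  If `m₁` is a monomial in the
variables indexed by `A` with nonzero coefficient `c₁` in `P_{G[A]}`, and `m₂` is a
monomial in the variables indexed by `B` with nonzero coefficient `c₂` in `P_{G[B]}`,
then the monomial `m₁ · m₂ · ∏_{y ∈ B} X_y ^ (b y)` has coefficient `±c₁c₂` in `P_G`;
in particular this coefficient is nonzero. -/
theorem coeff_graphPoly_of_partition {V : Type*} [Fintype V] [LinearOrder V]
    (G : SimpleGraph V) [DecidableRel G.Adj]
    (A B : Finset V) (hcover : A ∪ B = univ) (hdisj : Disjoint A B)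
    (m₁ m₂ : V →₀ ℕ)
    (hm₁ : ∀ v ∉ A, m₁ v = 0) (hm₂ : ∀ v ∉ B, m₂ v = 0)
    (hc₁ : MvPolynomial.coeff m₁ (graphPolyOn G A) ≠ 0)
    (hc₂ : MvPolynomial.coeff m₂ (graphPolyOn G B) ≠ 0) :
    (MvPolynomial.coeff
        (m₁ + m₂ + Finsupp.equivFunOnFinite.symm
          (fun v => if v ∈ B then (A.filter (fun x => G.Adj v x)).card else 0))
        (graphPoly G) =
        MvPolynomial.coeff m₁ (graphPolyOn G A) * MvPolynomial.coeff m₂ (graphPolyOn G B) ∨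
      MvPolynomial.coeff
        (m₁ + m₂ + Finsupp.equivFunOnFinite.symm
          (fun v => if v ∈ B then (A.filter (fun x => G.Adj v x)).card else 0))
        (graphPoly G) =
        -(MvPolynomial.coeff m₁ (graphPolyOn G A) *
          MvPolynomial.coeff m₂ (graphPolyOn G B))) ∧
    MvPolynomial.coeff
        (m₁ + m₂ + Finsupp.equivFunOnFinite.symm
          (fun v => if v ∈ B then (A.filter (fun x => G.Adj v x)).card else 0))
        (graphPoly G) ≠ 0 := by
  have h : ∀ v, v ∈ A ↔ v ∉ B := fun v =>
    ⟨fun hA => disjoint_left.1 hdisj hA, fun hB =>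
      (mem_union.1 (hcover ▸ mem_univ v)).resolve_right hB⟩
  have hA := graphPolyOn_mem_supported G A
  have hB := graphPolyOn_mem_supported G B
  have hsum : ∀ n, coeff n (graphPolyOn G A) ≠ 0 → ∑ v ∈ B, n v = 0 := fun n hn =>
    sum_eq_zero fun v hv => eq_zero_of_coeff_ne_zero_of_mem_supported hA hn
      (mem_coe.not.2 fun hvA => (h v).1 hvA hv)
  obtain ⟨d, hd⟩ := exists_isHomogeneous_graphPolyOn G B
  have hdeg : ∀ n, coeff n (graphPolyOn G B) ≠ 0 → ∑ v ∈ B, n v = d := by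
    intro n hn
    have hw : n.degree = d :=
      (DFunLike.congr_fun Finsupp.degree_eq_weight_one n).trans (hd hn)
    rw [← hw, Finsupp.degree_eq_sum]
    exact sum_subset (subset_univ B) fun v _ hv =>
      eq_zero_of_coeff_ne_zero_of_mem_supported hB hn (mem_coe.not.2 hv)
  obtain ⟨ε, hε, hcoeff⟩ := exists_sign_coeff_mul_prod_X_sub_X B (crossEdges G B)
    fun p hp => (mem_filter.1 hp).2.2.2
  have key := hcoeff (graphPolyOn G A * graphPolyOn G B) (m₁ + m₂) <| by
    intro n hn
    rw [coeff_mul] at hn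
    obtain ⟨⟨k, l⟩, hkl, hne⟩ := exists_ne_zero_of_sum_ne_zero hn
    obtain ⟨hk, hl⟩ := mul_ne_zero_iff.1 hne
    rw [← HasAntidiagonal.mem_antidiagonal.1 hkl]
    simp only [Finsupp.add_apply, sum_add_distrib]
    rw [hsum k hk, hdeg l hl, hsum m₁ hc₁, hdeg m₂ hc₂]
  rw [← graphPoly_eq_mul_prod_crossEdges G h, sum_crossEdges_single G h,
    coeff_add_mul_of_mem_supported (disjoint_coe.2 hdisj) hA hB hm₁ hm₂] at key
  rw [key]
  rcases hε with rfl | rfl <;> simp [hc₁, hc₂]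
end

section
/- Let G be a finite simple graph whose vertex set is partitioned as V(G) = X ⊔ Y, and suppose every vertex of Y has at most t neighbors in X. If the graph polynomial P_{G[X]} has a monomial with nonzero coefficient in which every variable has degree at most a−1, and P_{G[Y]} has a monomial with nonzero coefficient in which every variable has degree at most b−1, then P_G has a monomial with nonzero coefficient in which every variable has degree at most max(a, b+t) − 1. Consequently AT(G) ≤ max(a, b+t). -/
open MvPolynomial Finset

/-- The Alon–Tarsi number of `G`: the least `k` such that `P_G` has a monomial with
nonzero coefficient in which every variable has degree at most `k - 1`. -/
noncomputable def ATNumber {V : Type*} [Fintype V] [LinearOrder V]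
    (G : SimpleGraph V) [DecidableRel G.Adj] : ℕ :=
  sInf {k : ℕ | ∃ m : V →₀ ℕ, MvPolynomial.coeff m (graphPoly G) ≠ 0 ∧ ∀ v, m v < k}

section MaximalDegree

variable {V : Type*} [DecidableEq V]

/-- If `m` has maximal `B`-degree among the monomials of `P`, then multiplying `P` by
`X y - X x` with `y ∈ B` and `x ∉ B` does not change the coefficient of `m` shifted by `y`. -/
lemma coeff_add_single_mul_X_sub_X {B : Finset V} {P : MvPolynomial V ℝ} {m : V →₀ ℕ}
    (hmax : ∀ k, coeff k P ≠ 0 → ∑ v ∈ B, k v ≤ ∑ v ∈ B, m v)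
    {x y : V} (hy : y ∈ B) (hx : x ∉ B) :
    coeff (m + Finsupp.single y 1) (P * (X y - X x)) = coeff m P := by
  rw [mul_sub, coeff_sub, coeff_mul_X, coeff_mul_X', sub_eq_self]
  split_ifs with h
  · by_contra hne
    have hle := hmax _ hne
    have hsum : ∑ v ∈ B, (m + Finsupp.single y 1 - Finsupp.single x 1 : V →₀ ℕ) v
        = ∑ v ∈ B, m v + 1 := by
      rw [sum_congr rfl (g := fun v => m v + Finsupp.single y 1 v), sum_add_distrib]
      · simp [Finsupp.single_apply, hy]
      · intro v hv
        have : x ≠ v := fun h => hx (h ▸ hv)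
        simp [Finsupp.single_apply, this]
    omega
  · rfl

/-- Multiplication by `X p - X q` raises the `B`-degree by at most one. -/
lemma sum_le_of_coeff_mul_X_sub_X_ne_zero {B : Finset V} {P : MvPolynomial V ℝ} {d : ℕ}
    (hmax : ∀ k, coeff k P ≠ 0 → ∑ v ∈ B, k v ≤ d) (p q : V) {k : V →₀ ℕ}
    (hk : coeff k (P * (X p - X q)) ≠ 0) : ∑ v ∈ B, k v ≤ d + 1 := by
  have key : ∀ z : V, coeff k (P * X z) ≠ 0 → ∑ v ∈ B, k v ≤ d + 1 := by
    intro z hz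
    rw [coeff_mul_X'] at hz
    split_ifs at hz with h
    · have hle := hmax _ hz
      have hstep : ∑ v ∈ B, k v
          ≤ ∑ v ∈ B, ((k - Finsupp.single z 1 : V →₀ ℕ) v + Finsupp.single z 1 v) :=
        sum_le_sum fun v _ => by simp only [Finsupp.tsub_apply]; omega
      have hone : ∑ v ∈ B, Finsupp.single z 1 v ≤ 1 := by
        simp only [Finsupp.single_apply, sum_ite_eq]
        split_ifs <;> simp
      rw [sum_add_distrib] at hstep
      omega
    · exact absurd rfl hz
  by_cases hp : coeff k (P * X p) = 0
  · refine key q fun hq => hk ?_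
    rw [mul_sub, coeff_sub, hp, hq, sub_zero]
  · exact key p hp

/-- The endpoint in `B` of a pair exactly one of whose entries is in `B`. -/
def endpointIn (B : Finset V) (p : V × V) : V := if p.1 ∈ B then p.1 else p.2

/-- Multiplying by edge factors crossing the boundary of `B` keeps a coefficient of maximal
`B`-degree nonzero, when the monomial is shifted by the endpoints in `B`. -/
lemma coeff_mul_prod_crossing_ne_zero {B : Finset V} {P : MvPolynomial V ℝ} {m : V →₀ ℕ}
    (hm : coeff m P ≠ 0) (hmax : ∀ k, coeff k P ≠ 0 → ∑ v ∈ B, k v ≤ ∑ v ∈ B, m v)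
    (S : Finset (V × V)) (hS : ∀ p ∈ S, p.1 ∈ B ∧ p.2 ∉ B ∨ p.1 ∉ B ∧ p.2 ∈ B) :
    coeff (m + ∑ p ∈ S, Finsupp.single (endpointIn B p) 1)
      (P * ∏ p ∈ S, (X p.1 - X p.2)) ≠ 0 := by
  suffices h : coeff (m + ∑ p ∈ S, Finsupp.single (endpointIn B p) 1)
      (P * ∏ p ∈ S, (X p.1 - X p.2)) ≠ 0 ∧
      ∀ k, coeff k (P * ∏ p ∈ S, (X p.1 - X p.2)) ≠ 0 →
        ∑ v ∈ B, k v ≤ ∑ v ∈ B, (m + ∑ p ∈ S, Finsupp.single (endpointIn B p) 1 : V →₀ ℕ) v from h.1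
  induction S using Finset.induction_on with
  | empty => simpa using ⟨hm, hmax⟩
  | insert p S hp ih =>
    obtain ⟨hne, hle⟩ := ih fun q hq => hS q (mem_insert_of_mem hq)
    have hmem := hS p (mem_insert_self p S)
    rw [sum_insert hp, prod_insert hp, mul_comm (X p.1 - X p.2), ← mul_assoc,
      add_comm (Finsupp.single _ _), ← add_assoc]
    refine ⟨?_, fun k hk => ?_⟩
    · rcases hmem with ⟨h₁, h₂⟩ | ⟨h₁, h₂⟩
      · rw [endpointIn, if_pos h₁, coeff_add_single_mul_X_sub_X hle h₁ h₂]
        exact hne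
      · rw [endpointIn, if_neg h₁, ← neg_sub (X p.2) (X p.1), mul_neg, coeff_neg,
          coeff_add_single_mul_X_sub_X hle h₂ h₁]
        exact neg_ne_zero.2 hne
    · have hB : endpointIn B p ∈ B := by
        unfold endpointIn
        split_ifs with h
        · exact h
        · exact (hmem.resolve_left fun h' => h h'.1).2
      refine (sum_le_of_coeff_mul_X_sub_X_ne_zero hle p.1 p.2 hk).trans (le_of_eq ?_)
      simp only [Finsupp.add_apply _ (Finsupp.single _ _), sum_add_distrib]
      simp [Finsupp.single_apply, hB, sum_add_distrib]

end MaximalDegree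

section GraphPolynomial

variable {V : Type*} [Fintype V] [LinearOrder V]

/-- Monomials of `P_{G[s]}` only involve variables in `s`. -/
lemma apply_eq_zero_of_coeff_graphPolyOn_ne_zero (G : SimpleGraph V) [DecidableRel G.Adj]
    (s : Finset V) {m : V →₀ ℕ} (hm : coeff m (graphPolyOn G s) ≠ 0) {v : V} (hv : v ∉ s) :
    m v = 0 := by
  have hvars : (graphPolyOn G s).vars ⊆ s := by
    refine (vars_prod _).trans (biUnion_subset.2 fun p hp => (vars_sub_subset _).trans ?_)
    obtain ⟨-, -, h₁, h₂⟩ := (mem_filter.1 hp).2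
    simp [vars_X, insert_subset_iff, h₁, h₂]
  exact mem_support_notMem_vars_zero (mem_support_iff.2 hm) fun h => hv (hvars h)

/-- The graph polynomial of an induced subgraph is homogeneous. -/
lemma isHomogeneous_graphPolyOn (G : SimpleGraph V) [DecidableRel G.Adj] (s : Finset V) :
    ∃ n, (graphPolyOn G s).IsHomogeneous n :=
  ⟨_, IsHomogeneous.prod _ _ (fun _ => 1)
    fun p _ => (isHomogeneous_X ℝ p.1).sub (isHomogeneous_X ℝ p.2)⟩

/-- All monomials of `P_{G[s]}` have the same degree in the variables of `s`. -/
lemma sum_eq_sum_of_coeff_graphPolyOn_ne_zero (G : SimpleGraph V) [DecidableRel G.Adj]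
    (s : Finset V) {m m' : V →₀ ℕ} (hm : coeff m (graphPolyOn G s) ≠ 0)
    (hm' : coeff m' (graphPolyOn G s) ≠ 0) : ∑ v ∈ s, m v = ∑ v ∈ s, m' v := by
  obtain ⟨n, hn⟩ := isHomogeneous_graphPolyOn G s
  have key : ∀ k : V →₀ ℕ, coeff k (graphPolyOn G s) ≠ 0 → ∑ v ∈ s, k v = n := by
    intro k hk
    have hd : k.degree = n := by
      by_contra h
      exact hk (hn.coeff_eq_zero h)
    rw [← hd, Finsupp.degree_eq_sum]
    exact sum_subset (subset_univ s)
      fun v _ hv => apply_eq_zero_of_coeff_graphPolyOn_ne_zero G s hk hv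
  rw [key m hm, key m' hm']

/-- Coefficients of products of graph polynomials of disjoint induced subgraphs multiply. -/
lemma coeff_add_graphPolyOn_mul (G : SimpleGraph V) [DecidableRel G.Adj] {A B : Finset V}
    (hdisj : Disjoint A B) {m n : V →₀ ℕ} (hm : coeff m (graphPolyOn G A) ≠ 0)
    (hn : coeff n (graphPolyOn G B) ≠ 0) :
    coeff (m + n) (graphPolyOn G A * graphPolyOn G B)
      = coeff m (graphPolyOn G A) * coeff n (graphPolyOn G B) := by
  rw [coeff_mul]
  refine sum_eq_single_of_mem (m, n) (mem_antidiagonal.2 rfl) ?_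
  rintro ⟨i, j⟩ hij hne
  by_contra h
  obtain ⟨hi, hj⟩ := mul_ne_zero_iff.1 h
  have hadd : i + j = m + n := mem_antidiagonal.1 hij
  have him : i = m := by
    ext v
    by_cases hv : v ∈ A
    · have hvB := disjoint_left.1 hdisj hv
      have := DFunLike.congr_fun hadd v
      simpa [apply_eq_zero_of_coeff_graphPolyOn_ne_zero G B hj hvB,
        apply_eq_zero_of_coeff_graphPolyOn_ne_zero G B hn hvB] using this
    · rw [apply_eq_zero_of_coeff_graphPolyOn_ne_zero G A hi hv,
        apply_eq_zero_of_coeff_graphPolyOn_ne_zero G A hm hv]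
  subst him
  exact hne (by rw [add_left_cancel hadd])

/-- The edges of `G`, as increasing pairs, exactly one of whose ends is in `B`. -/
def crossingPairs (G : SimpleGraph V) [DecidableRel G.Adj] (B : Finset V) : Finset (V × V) :=
  univ.filter fun p => G.Adj p.1 p.2 ∧ p.1 < p.2 ∧ (p.1 ∈ B ∧ p.2 ∉ B ∨ p.1 ∉ B ∧ p.2 ∈ B)

lemma mem_crossingPairs {G : SimpleGraph V} [DecidableRel G.Adj] {B : Finset V} {p : V × V} :
    p ∈ crossingPairs G B ↔
      G.Adj p.1 p.2 ∧ p.1 < p.2 ∧ (p.1 ∈ B ∧ p.2 ∉ B ∨ p.1 ∉ B ∧ p.2 ∈ B) := by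
  simp [crossingPairs]

/-- Factorization of the graph polynomial along a partition of the vertex set. -/
lemma graphPoly_eq_mul_prod_crossingPairs (G : SimpleGraph V) [DecidableRel G.Adj]
    {A B : Finset V} (hA : ∀ v, v ∈ A ↔ v ∉ B) :
    graphPoly G =
      graphPolyOn G A * graphPolyOn G B * ∏ p ∈ crossingPairs G B, (X p.1 - X p.2) := by
  simp only [graphPoly, graphPolyOn, crossingPairs, prod_filter, ← prod_mul_distrib, hA]
  refine prod_congr rfl fun p _ => ?_
  by_cases h₁ : p.1 ∈ B <;> by_cases h₂ : p.2 ∈ B <;> simp [h₁, h₂]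

/-- The number of crossing pairs with end `v` in `B` is at most the number of neighbors of `v` in `A`. -/
lemma card_crossingPairs_endpointIn_le (G : SimpleGraph V) [DecidableRel G.Adj]
    {A B : Finset V} (hA : ∀ v, v ∈ A ↔ v ∉ B) (v : V) :
    ((crossingPairs G B).filter fun p => endpointIn B p = v).card
      ≤ (A.filter fun x => G.Adj v x).card := by
  refine card_le_card_of_injOn (fun p => if p.1 ∈ B then p.2 else p.1) ?_ ?_
  · intro p hp
    rw [mem_coe, mem_filter, mem_crossingPairs] at hp
    obtain ⟨⟨hadj, -, h⟩, rfl⟩ := hp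
    rcases h with ⟨h₁, h₂⟩ | ⟨h₁, h₂⟩
    · simp [endpointIn, h₁, h₂, hA, hadj]
    · simp [endpointIn, h₁, hA, hadj.symm]
  · intro p hp q hq hpq
    rw [mem_coe, mem_filter, mem_crossingPairs] at hp hq
    obtain ⟨⟨-, hlt, -⟩, rfl⟩ := hp
    obtain ⟨⟨-, hlt', -⟩, hpq'⟩ := hq
    simp only [endpointIn] at hpq hpq'
    by_cases h₁ : p.1 ∈ B <;> by_cases h₂ : q.1 ∈ B <;>
      simp only [h₁, h₂, if_true, if_false] at hpq hpq'
    · exact Prod.ext hpq'.symm hpq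
    · exact absurd (hpq ▸ hpq' ▸ hlt') hlt.asymm
    · exact absurd (hpq ▸ hpq' ▸ hlt') hlt.asymm
    · exact Prod.ext hpq hpq'.symm

end GraphPolynomial

/-- Let the vertex set of `G` be partitioned as `A ⊔ B` with every vertex of `B`
having at most `t` neighbors in `A`.  If `P_{G[A]}` has a monomial with nonzero
coefficient in which every variable has degree at most `a - 1`, and `P_{G[B]}` has a
monomial with nonzero coefficient in which every variable has degree at most `b - 1`,
then `P_G` has a monomial with nonzero coefficient in which every variable has degree
at most `max a (b + t) - 1`; consequently `AT(G) ≤ max a (b + t)`. -/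
theorem atNumber_le_of_partition {V : Type*} [Fintype V] [LinearOrder V]
    (G : SimpleGraph V) [DecidableRel G.Adj]
    (A B : Finset V) (hcover : A ∪ B = univ) (hdisj : Disjoint A B)
    (t a b : ℕ)
    (ht : ∀ y ∈ B, (A.filter (fun x => G.Adj y x)).card ≤ t)
    (hA : ∃ m : V →₀ ℕ, MvPolynomial.coeff m (graphPolyOn G A) ≠ 0 ∧ ∀ v, m v < a)
    (hB : ∃ m : V →₀ ℕ, MvPolynomial.coeff m (graphPolyOn G B) ≠ 0 ∧ ∀ v, m v < b) :
    (∃ m : V →₀ ℕ, MvPolynomial.coeff m (graphPoly G) ≠ 0 ∧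
      ∀ v, m v < max a (b + t)) ∧
    ATNumber G ≤ max a (b + t) := by
  obtain ⟨m, hm, hma⟩ := hA
  obtain ⟨n, hn, hnb⟩ := hB
  have hAB : ∀ v, v ∈ A ↔ v ∉ B := fun v =>
    ⟨fun h => disjoint_left.1 hdisj h, fun h =>
      (mem_union.1 (hcover ▸ mem_univ v : v ∈ A ∪ B)).resolve_right h⟩
  have hmB : ∀ k, coeff k (graphPolyOn G A) ≠ 0 → ∑ v ∈ B, k v = 0 := fun k hk =>
    sum_eq_zero fun v hv => apply_eq_zero_of_coeff_graphPolyOn_ne_zero G A hk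
      (disjoint_right.1 hdisj hv)
  have hbase : coeff (m + n) (graphPolyOn G A * graphPolyOn G B) ≠ 0 := by
    rw [coeff_add_graphPolyOn_mul G hdisj hm hn]
    exact mul_ne_zero hm hn
  have hmax : ∀ k, coeff k (graphPolyOn G A * graphPolyOn G B) ≠ 0 →
      ∑ v ∈ B, k v ≤ ∑ v ∈ B, (m + n) v := by
    intro k hk
    rw [coeff_mul] at hk
    obtain ⟨⟨i, j⟩, hij, hne⟩ := exists_ne_zero_of_sum_ne_zero hk
    obtain ⟨hi, hj⟩ := mul_ne_zero_iff.1 hne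
    obtain rfl : i + j = k := mem_antidiagonal.1 hij
    simp only [Finsupp.add_apply, sum_add_distrib, hmB i hi, hmB m hm,
      sum_eq_sum_of_coeff_graphPolyOn_ne_zero G B hj hn, le_refl]
  have hcross := coeff_mul_prod_crossing_ne_zero hbase hmax (crossingPairs G B)
    fun p hp => (mem_crossingPairs.1 hp).2.2
  rw [← graphPoly_eq_mul_prod_crossingPairs G hAB] at hcross
  have hmain : ∃ m : V →₀ ℕ, MvPolynomial.coeff m (graphPoly G) ≠ 0 ∧
      ∀ v, m v < max a (b + t) := by
    refine ⟨_, hcross, fun v => ?_⟩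
    have hc : (∑ p ∈ crossingPairs G B, Finsupp.single (endpointIn B p) 1 : V →₀ ℕ) v
        = ((crossingPairs G B).filter fun p => endpointIn B p = v).card := by
      simp [Finsupp.finsetSum_apply, Finsupp.single_apply]
    rw [Finsupp.add_apply, Finsupp.add_apply, hc]
    by_cases hv : v ∈ B
    · have hle := (card_crossingPairs_endpointIn_le G hAB v).trans (ht v hv)
      have hm0 := apply_eq_zero_of_coeff_graphPolyOn_ne_zero G A hm (disjoint_right.1 hdisj hv)
      have := hnb v
      omega
    · have hn0 := apply_eq_zero_of_coeff_graphPolyOn_ne_zero G B hn hv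
      have hc0 : ((crossingPairs G B).filter fun p => endpointIn B p = v).card = 0 := by
        refine card_eq_zero.2 (filter_eq_empty_iff.2 fun p hp hpv => hv ?_)
        subst hpv
        have h := (mem_crossingPairs.1 hp).2.2
        unfold endpointIn
        split_ifs with h₁
        · exact h₁
        · exact (h.resolve_left fun h' => h₁ h'.1).2
      have := hma v
      omega
  exact ⟨hmain, Nat.sInf_le hmain⟩
end

section
/- Let G be a finite simple graph whose vertex set is partitioned as V(G) = X ⊔ Y such that every vertex of Y has exactly 2 neighbors in X. If the graph polynomial P_{G[X]} has a monomial with nonzero coefficient in which every variable has degree at most 4, and P_{G[Y]} has a monomial with nonzero coefficient in which every variable has degree at most 2, then P_G has a monomial with nonzero coefficient in which every variable has degree at most 4; consequently AT(G) ≤ 5. (This is the algebraic content of the paper's theorem that AT(Ḡ_{ve}) ≤ 5 when G is a plane bipartite graph or a plane triangulation, in which cases the medial graph G[Y] has Alon–Tarsi number at most 3.) -/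
open MvPolynomial Finset

/-- In an exponent vanishing at `g e` for all `e ∈ S`, the coefficient of
`P * ∏ e ∈ S, (X (f e) - X (g e))` only sees the terms `X (f e)`. -/
lemma coeff_mul_prod_X_sub_X {σ ι R : Type*} [CommRing R] (P : MvPolynomial σ R)
    (S : Finset ι) (f g : ι → σ) (b : σ →₀ ℕ) (hb : ∀ e ∈ S, b (g e) = 0) :
    coeff b (P * ∏ e ∈ S, (X (f e) - X (g e))) = coeff b (P * ∏ e ∈ S, X (f e)) := by
  classical
  induction S using Finset.induction_on generalizing P with
  | empty => simp
  | insert e S he ih =>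
    rw [prod_insert he, prod_insert he, ← mul_assoc,
      ih _ fun e' he' => hb e' (mem_insert_of_mem he')]
    have h : P * (X (f e) - X (g e)) * ∏ e ∈ S, X (f e)
        = P * (X (f e) * ∏ e ∈ S, X (f e)) - (P * ∏ e ∈ S, X (f e)) * X (g e) := by ring
    rw [h, coeff_sub, coeff_mul_X', if_neg, sub_zero]
    simpa using hb e (mem_insert_self e S)

/-- The variables of a product of differences of variables are among those of its factors. -/
lemma exists_of_coeff_prod_X_sub_X_ne_zero {σ R : Type*} [CommRing R]
    (S : Finset (σ × σ)) {m : σ →₀ ℕ}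
    (hm : coeff m (∏ p ∈ S, (X p.1 - X p.2 : MvPolynomial σ R)) ≠ 0) {v : σ} (hv : m v ≠ 0) :
    ∃ p ∈ S, v = p.1 ∨ v = p.2 := by
  classical
  have : Nontrivial R := ⟨_, _, hm⟩
  have hmem : v ∈ (∏ p ∈ S, (X p.1 - X p.2 : MvPolynomial σ R)).vars :=
    (mem_vars_iff_mem_support v).2 ⟨m, mem_support_iff.2 hm, Finsupp.mem_support_iff.2 hv⟩
  obtain ⟨p, hp, h⟩ := mem_biUnion.1 (vars_prod _ hmem)
  refine ⟨p, hp, ?_⟩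
  simpa [vars_X] using vars_sub_subset _ h

/-- A product of differences of variables is homogeneous. -/
lemma isHomogeneous_prod_X_sub_X {σ R : Type*} [CommRing R] (S : Finset (σ × σ)) :
    (∏ p ∈ S, (X p.1 - X p.2 : MvPolynomial σ R)).IsHomogeneous S.card := by
  have h := IsHomogeneous.prod S (fun p => (X p.1 - X p.2 : MvPolynomial σ R)) (fun _ => 1)
    fun p _ => (isHomogeneous_X R p.1).sub (isHomogeneous_X R p.2)
  simpa using h

/-- If `P` is homogeneous and only involves variables outside the support of `b`, then the
coefficient of `P * Q` at `a + b` factors, provided `a` has the degree of `P`. -/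
lemma coeff_add_mul_of_isHomogeneous {σ R : Type*} [CommRing R] {P Q : MvPolynomial σ R} {n : ℕ}
    (hP : P.IsHomogeneous n) {a b : σ →₀ ℕ} (ha : coeff a P ≠ 0)
    (hb : ∀ c, coeff c P ≠ 0 → ∀ v, c v ≠ 0 → b v = 0) :
    coeff (a + b) (P * Q) = coeff a P * coeff b Q := by
  classical
  rw [coeff_mul, sum_eq_single (a, b)]
  · rintro ⟨c, d⟩ hcd hne
    rw [HasAntidiagonal.mem_antidiagonal] at hcd
    by_cases hc : coeff c P = 0
    · simp [hc]
    · have hle : c ≤ a := fun v => by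
        by_cases hv : c v = 0
        · simp [hv]
        · have h := DFunLike.congr_fun hcd v
          have := hb c hc v hv
          simp only [Finsupp.add_apply] at h
          omega
      obtain ⟨r, rfl⟩ := exists_add_of_le hle
      have h1 := hP hc
      have h2 := hP ha
      rw [map_add, h1] at h2
      have hr : r = 0 := by
        have h3 : Finsupp.weight (1 : σ → ℕ) r = 0 := by omega
        rw [← Finsupp.degree_eq_zero_iff, Finsupp.degree_eq_weight_one]
        exact h3
      subst hr
      simp_all
  · intro h
    simp at h

/-- Algebraic content of \`AT(Ḡ_{ve}) ≤ 5\` for plane bipartite graphs and triangulations: if \`V(G) = A ⊔ B\` with every vertex of \`B\` having exactly 2 neighbors in \`A\`, \`P_{G[A]}\` has a non-vanishing monomial with all degrees at most 4, and \`P_{G[B]}\` has a non-vanishing monomial with all degrees at most 2, then \`P_G\` has a non-vanishing monomial with all degrees at most 4; consequently \`AT(G) ≤ 5\`. -/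
theorem atNumber_le_five_facial_total {V : Type*} [Fintype V] [LinearOrder V]
    (G : SimpleGraph V) [DecidableRel G.Adj]
    (A B : Finset V) (hcover : A ∪ B = univ) (hdisj : Disjoint A B)
    (ht : ∀ y ∈ B, (A.filter (fun x => G.Adj y x)).card = 2)
    (hA : ∃ m : V →₀ ℕ, MvPolynomial.coeff m (graphPolyOn G A) ≠ 0 ∧ ∀ v, m v ≤ 4)
    (hB : ∃ m : V →₀ ℕ, MvPolynomial.coeff m (graphPolyOn G B) ≠ 0 ∧ ∀ v, m v ≤ 2) :
    (∃ m : V →₀ ℕ, MvPolynomial.coeff m (graphPoly G) ≠ 0 ∧ ∀ v, m v ≤ 4) ∧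
    ATNumber G ≤ 5 := by
  suffices h : ∃ m : V →₀ ℕ, MvPolynomial.coeff m (graphPoly G) ≠ 0 ∧ ∀ v, m v ≤ 4 by
    refine ⟨h, Nat.sInf_le ?_⟩
    obtain ⟨m, hm, hle⟩ := h
    exact ⟨m, hm, fun v => Nat.lt_succ_of_le (hle v)⟩
  obtain ⟨a, ha, ha4⟩ := hA
  obtain ⟨b, hb, hb2⟩ := hB
  have hAB : ∀ v, v ∈ B ↔ v ∉ A := fun v => by
    have h1 : v ∈ A ∪ B := hcover ▸ mem_univ v
    have h2 : v ∈ A → v ∉ B := fun h => Finset.disjoint_left.1 hdisj h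
    rw [mem_union] at h1
    tauto
  have hsupp : ∀ (s : Finset V) (c : V →₀ ℕ), coeff c (graphPolyOn G s) ≠ 0 →
      ∀ v, c v ≠ 0 → v ∈ s := by
    intro s c hc v hv
    obtain ⟨p, hp, h⟩ := exists_of_coeff_prod_X_sub_X_ne_zero _ hc hv
    simp only [mem_filter] at hp
    rcases h with rfl | rfl
    exacts [hp.2.2.2.1, hp.2.2.2.2]
  set E := univ.filter (fun p : V × V => G.Adj p.1 p.2 ∧ p.1 < p.2 ∧ (p.1 ∈ A ↔ p.2 ∉ A))
    with hE
  let f : V × V → V := fun p => if p.1 ∈ A then p.2 else p.1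
  let g : V × V → V := fun p => if p.1 ∈ A then p.1 else p.2
  have hfg : ∀ p ∈ E, f p ∉ A ∧ g p ∈ A ∧ G.Adj (f p) (g p) ∧
      p = (min (f p) (g p), max (f p) (g p)) := by
    rintro ⟨x, y⟩ hp
    simp only [hE, mem_filter, mem_univ, true_and] at hp
    obtain ⟨hadj, hlt, hiff⟩ := hp
    by_cases hx : x ∈ A
    · simp [f, g, hx, hiff.1 hx, hadj.symm, hlt.le]
    · have hy : y ∈ A := by tauto
      simp [f, g, hx, hy, hadj, hlt.le]
  have hsplit : graphPoly G = graphPolyOn G A *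
      (graphPolyOn G B * ∏ p ∈ E, (X p.1 - X p.2)) := by
    unfold graphPoly graphPolyOn
    rw [← prod_union, ← prod_union]
    · congr 1
      ext p
      simp only [hE, mem_union, mem_filter, mem_univ, true_and, hAB]
      tauto
    · rw [Finset.disjoint_left]
      intro p
      simp only [hE, mem_union, mem_filter, mem_univ, true_and, hAB]
      tauto
    · rw [Finset.disjoint_left]
      intro p
      simp only [hE, mem_filter, mem_univ, true_and, hAB]
      tauto
  have hsign : ∏ p ∈ E, (X p.1 - X p.2 : MvPolynomial V ℝ) =
      C (∏ p ∈ E, if p.1 ∈ A then (-1 : ℝ) else 1) * ∏ p ∈ E, (X (f p) - X (g p)) := by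
    rw [map_prod, ← prod_mul_distrib]
    refine prod_congr rfl fun p _ => ?_
    by_cases h : p.1 ∈ A <;> simp [f, g, h]
  let d : V →₀ ℕ := ∑ p ∈ E, Finsupp.single (f p) 1
  have hd : ∀ v, d v = (E.filter (fun p => f p = v)).card := fun v => by
    rw [card_filter]
    simp only [d, Finsupp.finsetSum_apply, Finsupp.single_apply]
  have hdA : ∀ v ∈ A, d v = 0 := fun v hv => by
    rw [hd, card_eq_zero, filter_eq_empty_iff]
    rintro p hp rfl
    exact (hfg p hp).1 hv
  have hdB : ∀ v ∈ B, d v ≤ 2 := fun v hv => by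
    rw [hd, ← ht v hv]
    refine card_le_card_of_injOn g (fun p hp => ?_) fun p hp q hq hpq => ?_
    · simp only [coe_filter, Set.mem_ofPred_eq] at hp ⊢
      obtain ⟨hpE, rfl⟩ := hp
      exact ⟨(hfg p hpE).2.1, (hfg p hpE).2.2.1⟩
    · simp only [coe_filter, Set.mem_ofPred_eq] at hp hq
      rw [(hfg p hp.1).2.2.2, (hfg q hq.1).2.2.2, hp.2, hq.2, hpq]
  have hprod : ∏ p ∈ E, (X (f p) : MvPolynomial V ℝ) = monomial d 1 := by
    simp only [X, d, monomial_sum_one]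
  have hbA : ∀ v ∈ A, b v = 0 := fun v hv => by
    by_contra h
    exact (hAB v).1 (hsupp B b hb v h) hv
  refine ⟨a + (b + d), ?_, fun v => ?_⟩
  · rw [hsplit, coeff_add_mul_of_isHomogeneous (P := graphPolyOn G A)
      (isHomogeneous_prod_X_sub_X _) ha]
    · refine mul_ne_zero ha ?_
      rw [hsign, mul_left_comm, coeff_C_mul, coeff_mul_prod_X_sub_X, hprod, coeff_mul_monomial,
        mul_one]
      · refine mul_ne_zero (prod_ne_zero_iff.2 fun p _ => ?_) hb
        split_ifs <;> norm_num
      · intro p hp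
        have h := (hfg p hp).2.1
        simp [hbA _ h, hdA _ h]
    · intro c hc v hv
      have h := hsupp A c hc v hv
      simp [hbA _ h, hdA _ h]
  · simp only [Finsupp.add_apply]
    by_cases h : v ∈ A
    · simpa [hbA _ h, hdA _ h] using ha4 v
    · have h1 : a v = 0 := by
        by_contra h'
        exact h (hsupp A a ha v h')
      have h2 := hb2 v
      have h3 := hdB v ((hAB v).2 h)
      omega
end

section
/- Let G be a finite simple graph whose vertex set is partitioned as V(G) = X ⊔ Y such that every vertex of Y has exactly 4 neighbors in X. Suppose G[X] admits an acyclic orientation in which every vertex has indegree at most 7, and the graph polynomial P_{G[Y]} has a monomial with nonzero coefficient in which every variable has degree at most 3. Then P_G has a monomial with nonzero coefficient in which every variable has degree at most 7; consequently AT(G) ≤ 8. (This is the algebraic content of the paper's theorem that AT(Ḡ_{vef}) ≤ 8 for every plane graph G, with X the union of vertices and faces, on which the vertex–face graph G_{vf} is 7-degenerate, Y the edge set carrying the medial graph, and each edge incident to exactly 2 vertices and 2 faces.) -/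
open MvPolynomial Finset

noncomputable instance {V : Type*} (G : SimpleGraph V) (s : Set V) :
    DecidableRel (G.induce s).Adj := fun _ _ => Classical.propDecidable _

/-- Every monomial of `f` has weight less than `n`. -/
def WeightLT {V : Type*} (w : V → ℕ) (n : ℕ) (f : MvPolynomial V ℝ) : Prop :=
  ∀ m, coeff m f ≠ 0 → Finsupp.weight w m < n

/-- `g` is weighted homogeneous of weight `n`, and `f - g` only has monomials of smaller weight. -/
def HasLeadingForm {V : Type*} (w : V → ℕ) (n : ℕ) (f g : MvPolynomial V ℝ) : Prop :=
  IsWeightedHomogeneous w g n ∧ WeightLT w n (f - g)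

theorem exists_coeff_ne_zero_of_coeff_mul_ne_zero {V : Type*} {f g : MvPolynomial V ℝ} {m : V →₀ ℕ}
    (h : coeff m (f * g) ≠ 0) : ∃ a b, a + b = m ∧ coeff a f ≠ 0 ∧ coeff b g ≠ 0 := by
  classical
  rw [coeff_mul] at h
  obtain ⟨p, hp, hne⟩ := exists_ne_zero_of_sum_ne_zero h
  exact ⟨p.1, p.2, mem_antidiagonal.mp hp, left_ne_zero_of_mul hne, right_ne_zero_of_mul hne⟩

theorem WeightLT.add {V : Type*} {w : V → ℕ} {n : ℕ} {f g : MvPolynomial V ℝ}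
    (hf : WeightLT w n f) (hg : WeightLT w n g) : WeightLT w n (f + g) := by
  intro m hm
  by_cases h : coeff m f = 0
  · exact hg m (by simpa [h] using hm)
  · exact hf m h

theorem HasLeadingForm.mul {V : Type*} {w : V → ℕ} {n k : ℕ} {f g f' g' : MvPolynomial V ℝ}
    (h : HasLeadingForm w n f g) (h' : HasLeadingForm w k f' g') :
    HasLeadingForm w (n + k) (f * f') (g * g') := by
  refine ⟨h.1.mul h'.1, ?_⟩
  have key : f * f' - g * g' = ((f - g) * (f' - g') + (f - g) * g') + g * (f' - g') := by ring
  rw [key]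
  refine (WeightLT.add ?_ ?_).add ?_
  all_goals
    intro m hm
    obtain ⟨a, b, rfl, ha, hb⟩ := exists_coeff_ne_zero_of_coeff_mul_ne_zero hm
    rw [map_add]
  · exact add_lt_add (h.2 a ha) (h'.2 b hb)
  · exact add_lt_add_of_lt_of_le (h.2 a ha) (h'.1 hb).le
  · exact add_lt_add_of_le_of_lt (h.1 ha).le (h'.2 b hb)

theorem HasLeadingForm.prod {V ι : Type*} {w : V → ℕ} (s : Finset ι) (n : ι → ℕ)
    (f g : ι → MvPolynomial V ℝ) (h : ∀ i ∈ s, HasLeadingForm w (n i) (f i) (g i)) :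
    HasLeadingForm w (∑ i ∈ s, n i) (∏ i ∈ s, f i) (∏ i ∈ s, g i) := by
  classical
  induction s using Finset.induction_on with
  | empty => exact ⟨by simpa using isWeightedHomogeneous_one ℝ w, by simp [WeightLT]⟩
  | insert i s hi ih =>
    rw [sum_insert hi, prod_insert hi, prod_insert hi]
    exact (h i (mem_insert_self i s)).mul (ih fun j hj => h j (mem_insert_of_mem hj))

theorem HasLeadingForm.coeff_eq {V : Type*} {w : V → ℕ} {n : ℕ} {f g : MvPolynomial V ℝ}
    (h : HasLeadingForm w n f g) {m : V →₀ ℕ} (hm : coeff m g ≠ 0) : coeff m f = coeff m g := by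
  by_contra hne
  have := h.2 m (by simpa [sub_eq_zero] using hne)
  exact this.ne (h.1 hm)

theorem weightLT_X {V : Type*} {w : V → ℕ} {n : ℕ} {v : V} (h : w v < n) :
    WeightLT w n (X v) := fun _ hm => by
  rwa [isWeightedHomogeneous_X ℝ w v hm]

theorem WeightLT.neg {V : Type*} {w : V → ℕ} {n : ℕ} {f : MvPolynomial V ℝ}
    (hf : WeightLT w n f) : WeightLT w n (-f) := fun m hm => hf m (by simpa using hm)

theorem hasLeadingForm_X_sub_X_of_eq {V : Type*} {w : V → ℕ} {u v : V} (h : w u = w v) :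
    HasLeadingForm w (w v) (X u - X v) (X u - X v) := by
  refine ⟨?_, by simp [WeightLT]⟩
  have hu := isWeightedHomogeneous_X ℝ w u
  rw [h] at hu
  exact (weightedHomogeneousSubmodule ℝ w (w v)).sub_mem hu (isWeightedHomogeneous_X ℝ w v)

theorem hasLeadingForm_X_sub_X_of_lt {V : Type*} {w : V → ℕ} {u v : V} (h : w u < w v) :
    HasLeadingForm w (w v) (X u - X v) (monomial (Finsupp.single v 1) (-1)) := by
  have e : (monomial (Finsupp.single v 1) (-1) : MvPolynomial V ℝ) = -X v := by simp [X]
  rw [e]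
  refine ⟨(weightedHomogeneousSubmodule ℝ w (w v)).neg_mem (isWeightedHomogeneous_X ℝ w v), ?_⟩
  rw [sub_neg_eq_add, sub_add_cancel]
  exact weightLT_X h

theorem hasLeadingForm_X_sub_X_of_gt {V : Type*} {w : V → ℕ} {u v : V} (h : w v < w u) :
    HasLeadingForm w (w u) (X u - X v) (monomial (Finsupp.single u 1) 1) := by
  refine ⟨isWeightedHomogeneous_X ℝ w u, ?_⟩
  change WeightLT w (w u) (X u - X v - X u)
  rw [sub_sub_cancel_left]
  exact (weightLT_X h).neg

theorem prod_monomial {V ι : Type*} (s : Finset ι) (d : ι → V →₀ ℕ) (c : ι → ℝ) :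
    ∏ i ∈ s, monomial (d i) (c i) = monomial (∑ i ∈ s, d i) (∏ i ∈ s, c i) := by
  classical
  induction s using Finset.induction_on with
  | empty => simp
  | insert i s hi ih => rw [prod_insert hi, ih, monomial_mul, sum_insert hi, prod_insert hi]

theorem eq_zero_of_coeff_graphPolyOn_ne_zero {V : Type*} [Fintype V] [LinearOrder V]
    {G : SimpleGraph V} [DecidableRel G.Adj] {s : Finset V} {m : V →₀ ℕ}
    (hm : coeff m (graphPolyOn G s) ≠ 0) {v : V} (hv : v ∉ s) : m v = 0 := by
  refine (mem_support_notMem_vars_zero (mem_support_iff.mpr hm)) fun hmem => hv ?_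
  obtain ⟨p, hp, hvp⟩ := mem_biUnion.mp (vars_prod _ hmem)
  rcases mem_union.mp (vars_sub_subset _ hvp) with h | h <;>
    simp only [vars_X, mem_singleton] at h <;> simp_all

/-- If a weight `w` is constant on `B` and injective along all edges not inside `B`, then a monomial
of `P_{G[B]}` extends to one of `P_G`, whose degree at `v` grows by at most the number of
neighbors of `v` of smaller weight. -/
theorem exists_coeff_graphPoly_ne_zero {V : Type*} [Fintype V] [LinearOrder V]
    (G : SimpleGraph V) [DecidableRel G.Adj] (B : Finset V) (w : V → ℕ)
    (hconst : ∀ u ∈ B, ∀ v ∈ B, w u = w v)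
    (hne : ∀ u v, G.Adj u v → ¬ (u ∈ B ∧ v ∈ B) → w u ≠ w v)
    {m : V →₀ ℕ} (hm : coeff m (graphPolyOn G B) ≠ 0) :
    ∃ m' : V →₀ ℕ, coeff m' (graphPoly G) ≠ 0 ∧
      ∀ v, m' v ≤ m v + #{u | G.Adj u v ∧ w u < w v} := by
  classical
  let hd : V × V → V := fun p => if w p.1 < w p.2 then p.2 else p.1
  let c : V × V → ℝ := fun p => if w p.1 < w p.2 then -1 else 1
  let E : Finset (V × V) := univ.filter fun p => G.Adj p.1 p.2 ∧ p.1 < p.2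
  let inB : V × V → Prop := fun p => p.1 ∈ B ∧ p.2 ∈ B
  let g : V × V → MvPolynomial V ℝ := fun p =>
    if inB p then X p.1 - X p.2 else monomial (Finsupp.single (hd p) 1) (c p)
  have hlead : HasLeadingForm w (∑ p ∈ E, w (hd p)) (graphPoly G) (∏ p ∈ E, g p) := by
    refine HasLeadingForm.prod E _ _ _ fun p hp => ?_
    obtain ⟨hadj, -⟩ := (mem_filter.mp hp).2
    by_cases hin : inB p
    · have hw := hconst _ hin.1 _ hin.2
      simpa [g, hd, hin, hw] using hasLeadingForm_X_sub_X_of_eq hw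
    · rcases lt_or_gt_of_ne (hne _ _ hadj hin) with h | h
      · simpa only [g, hd, c, hin, h, if_true, if_false] using hasLeadingForm_X_sub_X_of_lt h
      · simpa only [g, hd, c, hin, h.not_gt, if_false] using hasLeadingForm_X_sub_X_of_gt h
  let d : V →₀ ℕ := ∑ p ∈ E with ¬ inB p, Finsupp.single (hd p) 1
  have hprod : ∏ p ∈ E, g p =
      graphPolyOn G B * monomial d (∏ p ∈ E with ¬ inB p, c p) := by
    rw [← prod_filter_mul_prod_filter_not E inB]
    congr 1
    · have hE : E.filter inB =
          univ.filter fun p : V × V => G.Adj p.1 p.2 ∧ p.1 < p.2 ∧ p.1 ∈ B ∧ p.2 ∈ B := by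
        ext p; simp [E, inB, and_assoc]
      rw [graphPolyOn, ← hE]
      exact prod_congr rfl fun p hp => if_pos (mem_filter.mp hp).2
    · rw [← prod_monomial]
      exact prod_congr rfl fun p hp => if_neg (mem_filter.mp hp).2
  have hc : ∏ p ∈ E with ¬ inB p, c p ≠ 0 :=
    prod_ne_zero_iff.mpr fun p _ => by dsimp only [c]; split_ifs <;> norm_num
  have hcoeff : coeff (m + d) (∏ p ∈ E, g p) ≠ 0 := by
    rw [hprod, coeff_mul_monomial]
    exact mul_ne_zero hm hc
  refine ⟨m + d, by rwa [hlead.coeff_eq hcoeff], fun v => ?_⟩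
  rw [Finsupp.add_apply]
  refine Nat.add_le_add_left ?_ _
  have hdv : d v = #{p ∈ E | ¬ inB p ∧ hd p = v} := by
    rw [← filter_filter, card_filter, Finsupp.finsetSum_apply]
    exact sum_congr rfl fun p _ => Finsupp.single_apply
  rw [hdv]
  refine card_le_card_of_injOn (fun p => if p.1 = v then p.2 else p.1) ?_ ?_
  · intro p hp
    simp only [E, coe_filter, mem_filter, mem_univ, true_and, Set.mem_ofPred_eq] at hp ⊢
    obtain ⟨⟨hadj, hlt⟩, hin, rfl⟩ := hp
    rcases lt_or_gt_of_ne (hne _ _ hadj hin) with h | h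
    · simp [hd, h, hlt.ne, hadj]
    · simp [hd, h, h.not_gt, hadj.symm]
  · rintro ⟨p, q⟩ hp ⟨p', q'⟩ hp' heq
    simp only [E, hd, coe_filter, mem_filter, mem_univ, true_and, Set.mem_ofPred_eq] at hp hp' heq
    grind

/-- An acyclic relation on a finite type has a strictly increasing rank function. -/
theorem exists_rank_of_acyclic {α : Type*} [Fintype α] (r : α → α → Prop)
    (hr : ∀ a, ¬ Relation.TransGen r a a) :
    ∃ f : α → ℕ, (∀ a, f a ≤ Fintype.card α) ∧ ∀ a b, r a b → f a < f b := by
  classical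
  refine ⟨fun b => #{a | Relation.TransGen r a b}, fun a => card_le_univ _, fun a b hab => ?_⟩
  refine card_lt_card (ssubset_iff_of_subset ?_ |>.mpr ⟨a, ?_, ?_⟩)
  · intro c hc
    simp only [mem_filter, mem_univ, true_and] at hc ⊢
    exact hc.tail hab
  · simpa using Relation.TransGen.single hab
  · simpa using hr a

theorem orientRel_or_orientRel {V : Type*} [Fintype V] [DecidableEq V]
    (G : SimpleGraph V) [DecidableRel G.Adj] (o : GraphOrientation G) {u v : V} (h : G.Adj u v) :
    orientRel G o u v ∨ orientRel G o v u := by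
  have hmem := (o ⟨s(u, v), SimpleGraph.mem_edgeFinset.mpr h⟩).2
  rcases Sym2.mem_iff.mp hmem with e | e
  · refine .inr ⟨h.symm, ?_⟩
    have hs : (⟨s(v, u), SimpleGraph.mem_edgeFinset.mpr h.symm⟩ : G.edgeFinset) =
        ⟨s(u, v), SimpleGraph.mem_edgeFinset.mpr h⟩ := Subtype.ext Sym2.eq_swap
    rw [hs]
    exact e
  · exact .inl ⟨h, e⟩

theorem card_le_indeg {V : Type*} [Fintype V] [DecidableEq V]
    (G : SimpleGraph V) [DecidableRel G.Adj] (o : GraphOrientation G) (v : V) (s : Finset V)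
    (hs : ∀ u ∈ s, orientRel G o u v) : #s ≤ indeg G o v := by
  refine card_le_card_of_forall_subsingleton
    (fun u (e : G.edgeFinset) => (e : Sym2 V) = s(u, v)) ?_ ?_
  · intro u hu
    obtain ⟨h, ho⟩ := hs u hu
    exact ⟨_, mem_filter.mpr ⟨mem_univ _, ho⟩, rfl⟩
  · rintro e - u ⟨-, hu⟩ u' ⟨-, hu'⟩
    exact Sym2.congr_left.mp (hu.symm.trans hu')

/-- Algebraic content of `AT(Ḡ_{vef}) ≤ 8`: let `V(G) = A ⊔ B` with every vertex of
`B` having exactly 4 neighbors in `A`.  If `G[A]` admits an acyclic orientation with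
all indegrees at most 7, and `P_{G[B]}` has a non-vanishing monomial with all degrees
at most 3, then `P_G` has a non-vanishing monomial with all degrees at most 7;
consequently `AT(G) ≤ 8`. -/
theorem atNumber_le_eight_facial_entire {V : Type*} [Fintype V] [LinearOrder V]
    (G : SimpleGraph V) [DecidableRel G.Adj]
    (A B : Finset V) (hcover : A ∪ B = univ) (hdisj : Disjoint A B)
    (ht : ∀ y ∈ B, (A.filter (fun x => G.Adj y x)).card = 4)
    (hA : ∃ o : GraphOrientation (G.induce (A : Set V)),
      AcyclicOrientation (G.induce (A : Set V)) o ∧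
        ∀ v, indeg (G.induce (A : Set V)) o v ≤ 7)
    (hB : ∃ m : V →₀ ℕ, MvPolynomial.coeff m (graphPolyOn G B) ≠ 0 ∧ ∀ v, m v ≤ 3) :
    (∃ m : V →₀ ℕ, MvPolynomial.coeff m (graphPoly G) ≠ 0 ∧ ∀ v, m v ≤ 7) ∧
    ATNumber G ≤ 8 := by
  classical
  suffices h : ∃ m : V →₀ ℕ, coeff m (graphPoly G) ≠ 0 ∧ ∀ v, m v ≤ 7 by
    obtain ⟨m, hm, hle⟩ := h
    exact ⟨⟨m, hm, hle⟩, Nat.sInf_le ⟨m, hm, fun v => Nat.lt_succ_of_le (hle v)⟩⟩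
  obtain ⟨o, hac, hind⟩ := hA
  obtain ⟨m, hm, hm3⟩ := hB
  obtain ⟨f, hf, hfr⟩ := exists_rank_of_acyclic _ hac
  let w : V → ℕ := fun v =>
    if h : v ∈ A then f ⟨v, h⟩ else Fintype.card (A : Set V) + 1
  have hwA : ∀ v (h : v ∈ A), w v = f ⟨v, h⟩ := fun v h => dif_pos h
  have hwB : ∀ v, v ∉ A → w v = Fintype.card (A : Set V) + 1 := fun v h => dif_neg h
  have hwlt : ∀ u ∈ A, ∀ v, v ∉ A → w u < w v := fun u hu v hv => by
    rw [hwA u hu, hwB v hv]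
    exact Nat.lt_succ_of_le (hf _)
  have hAB : ∀ v, v ∈ B ↔ v ∉ A := fun v => by
    refine ⟨fun hb ha => disjoint_left.mp hdisj ha hb, fun ha => ?_⟩
    exact (mem_union.mp (hcover ▸ mem_univ v)).resolve_left ha
  have horient : ∀ u v (hu : u ∈ A) (hv : v ∈ A), G.Adj u v →
      orientRel (G.induce (A : Set V)) o ⟨u, hu⟩ ⟨v, hv⟩ ∨
        orientRel (G.induce (A : Set V)) o ⟨v, hv⟩ ⟨u, hu⟩ := fun u v hu hv h =>
    orientRel_or_orientRel (G.induce (A : Set V)) o h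
  obtain ⟨m', hm', hle⟩ := exists_coeff_graphPoly_ne_zero G B w
    (fun u hu v hv => by rw [hwB u ((hAB u).mp hu), hwB v ((hAB v).mp hv)])
    (fun u v hadj hin => by
      rw [hAB, hAB] at hin
      by_cases hu : u ∈ A <;> by_cases hv : v ∈ A
      · rw [hwA u hu, hwA v hv]
        exact (horient u v hu hv hadj).elim (fun h => (hfr _ _ h).ne) (fun h => (hfr _ _ h).ne')
      · exact (hwlt u hu v hv).ne
      · exact (hwlt v hv u hu).ne'
      · exact absurd ⟨hu, hv⟩ hin) hm
  refine ⟨m', hm', fun v => (hle v).trans ?_⟩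
  by_cases hv : v ∈ A
  · rw [eq_zero_of_coeff_graphPolyOn_ne_zero hm (fun h => (hAB v).mp h hv), zero_add]
    have hsub : ∀ u ∈ univ.filter (fun u => G.Adj u v ∧ w u < w v), u ∈ (A : Set V) := by
      intro u hu
      by_contra hu'
      exact (mem_filter.mp hu).2.2.not_gt (hwlt v hv u hu')
    have hcard := congrArg card (subtype_map_of_mem hsub)
    rw [card_map] at hcard
    rw [← hcard]
    refine (card_le_indeg (G.induce (A : Set V)) o ⟨v, hv⟩ _ ?_).trans (hind ⟨v, hv⟩)
    rintro ⟨u, hu⟩ hmem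
    obtain ⟨hadj, hlt⟩ := (mem_filter.mp (mem_subtype.mp hmem)).2
    refine (horient u v hu hv hadj).resolve_right fun h => ?_
    rw [hwA u hu, hwA v hv] at hlt
    exact (hfr _ _ h).not_gt hlt
  · have hsub : univ.filter (fun u => G.Adj u v ∧ w u < w v) ⊆ A.filter (fun x => G.Adj v x) := by
      intro u hu
      obtain ⟨hadj, hlt⟩ := (mem_filter.mp hu).2
      refine mem_filter.mpr ⟨?_, hadj.symm⟩
      by_contra hu'
      rw [hwB u hu', hwB v hv] at hlt
      exact lt_irrefl _ hlt
    exact add_le_add (hm3 v) ((card_le_card hsub).trans (ht v ((hAB v).mpr hv)).le)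
end

section
/- Let G be a finite simple graph with vertex set {x₁,…,x_k} ∪ {y₁,…,y_l} (disjoint union, k ≥ 1, l ≥ 0). Suppose the graph polynomial P_G has a monomial with nonzero coefficient whose degree in x_i is α_i for each i and whose degree in y_j is β_j for each j. Then there exists an independent set X' ⊆ {x₁,…,x_k} of G such that the graph polynomial P_{G−X'} of the induced subgraph on V(G) ∖ X' has a monomial with nonzero coefficient whose degree in each x_i ∉ X' is at most α_i − 1 (so in particular α_i ≥ 1 for every x_i ∉ X') and whose degree in each y_j is at most β_j. -/
open MvPolynomial Finset

/-- The linear functional on polynomials sending each monic monomial to its weight. -/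
noncomputable def monomialFunctional {V : Type*} (w : (V →₀ ℕ) → ℝ) : MvPolynomial V ℝ →ₗ[ℝ] ℝ :=
  (basisMonomials V ℝ).constr ℝ w

lemma monomialFunctional_monomial {V : Type*} (w : (V →₀ ℕ) → ℝ) (n : V →₀ ℕ) :
    monomialFunctional w (monomial n 1) = w n := by
  have h := (basisMonomials V ℝ).constr_basis ℝ w n
  rwa [coe_basisMonomials] at h

lemma monomialFunctional_apply {V : Type*} (w : (V →₀ ℕ) → ℝ) (p : MvPolynomial V ℝ) :
    monomialFunctional w p = ∑ n ∈ p.support, coeff n p * w n := by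
  conv_lhs => rw [p.as_sum]
  rw [map_sum]
  refine sum_congr rfl fun n _ ↦ ?_
  rw [← mul_one (coeff n p), ← smul_eq_mul, ← smul_monomial, map_smul,
    monomialFunctional_monomial, smul_eq_mul, smul_eq_mul, mul_one]

/-- The substitution of `1` for all variables in `S`. -/
noncomputable def substOne {V : Type*} [DecidableEq V] (S : Finset V) :
    MvPolynomial V ℝ →ₐ[ℝ] MvPolynomial V ℝ :=
  aeval fun v ↦ if v ∈ S then 1 else X v

lemma substOne_monomial {V : Type*} [DecidableEq V] (S : Finset V) (n : V →₀ ℕ) :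
    substOne S (monomial n 1) = monomial (n.filter (· ∉ S)) 1 := by
  rw [substOne, aeval_monomial, map_one, one_mul, monomial_eq, C_1, one_mul,
    Finsupp.prod_filter_index, Finsupp.support_filter, prod_filter, Finsupp.prod]
  refine prod_congr rfl fun v _ ↦ ?_
  by_cases hv : v ∈ S <;> simp [hv]

lemma monomialFunctional_substOne {V : Type*} [DecidableEq V] {S : Finset V}
    {w : (V →₀ ℕ) → ℝ} (hw : ∀ n, w (n.filter (· ∉ S)) = w n) (p : MvPolynomial V ℝ) :
    monomialFunctional w (substOne S p) = monomialFunctional w p := by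
  have h : monomialFunctional w ∘ₗ (substOne S).toLinearMap = monomialFunctional w := by
    refine (basisMonomials V ℝ).ext fun n ↦ ?_
    simp only [coe_basisMonomials, LinearMap.comp_apply, AlgHom.toLinearMap_apply,
      substOne_monomial, monomialFunctional_monomial, hw]
  exact LinearMap.congr_fun h p

lemma exists_le_coeff_ne_zero_of_coeff_mul_ne_zero {V R : Type*} [CommSemiring R]
    {p q : MvPolynomial V R} {n : V →₀ ℕ} (h : coeff n (p * q) ≠ 0) :
    ∃ m ≤ n, coeff m p ≠ 0 := by
  classical
  rw [coeff_mul] at h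
  obtain ⟨x, hx, hne⟩ := exists_ne_zero_of_sum_ne_zero h
  refine ⟨x.1, ?_, left_ne_zero_of_mul hne⟩
  rw [← mem_antidiagonal.1 hx]
  exact le_self_add

lemma graphPoly_isHomogeneous {V : Type*} [Fintype V] [LinearOrder V]
    (G : SimpleGraph V) [DecidableRel G.Adj] :
    (graphPoly G).IsHomogeneous
      (∑ _p ∈ univ.filter (fun p : V × V => G.Adj p.1 p.2 ∧ p.1 < p.2), 1) :=
  IsHomogeneous.prod _ _ _ fun p _ ↦ (isHomogeneous_X ℝ p.1).sub (isHomogeneous_X ℝ p.2)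

lemma not_adj_of_substOne_graphPoly_ne_zero {V : Type*} [Fintype V] [LinearOrder V]
    (G : SimpleGraph V) [DecidableRel G.Adj] {S : Finset V}
    (h : substOne S (graphPoly G) ≠ 0) : ∀ u ∈ S, ∀ v ∈ S, ¬ G.Adj u v := by
  have key : ∀ u ∈ S, ∀ v ∈ S, u < v → ¬ G.Adj u v := by
    intro u hu v hv huv hadj
    apply h
    rw [graphPoly, map_prod]
    refine prod_eq_zero (i := (u, v)) (by simp [hadj, huv]) ?_
    simp [substOne, hu, hv]
  intro u hu v hv hadj
  rcases lt_trichotomy u v with huv | rfl | huv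
  · exact key u hu v hv huv hadj
  · exact G.loopless.irrefl u hadj
  · exact key v hv u hu huv hadj.symm

lemma graphPolyOn_dvd_substOne_graphPoly {V : Type*} [Fintype V] [LinearOrder V]
    (G : SimpleGraph V) [DecidableRel G.Adj] (S : Finset V) :
    graphPolyOn G Sᶜ ∣ substOne S (graphPoly G) := by
  have h : graphPolyOn G Sᶜ =
      ∏ p ∈ univ.filter (fun p : V × V => G.Adj p.1 p.2 ∧ p.1 < p.2 ∧ p.1 ∈ Sᶜ ∧ p.2 ∈ Sᶜ),
        substOne S (X p.1 - X p.2) := by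
    refine prod_congr rfl fun p hp ↦ ?_
    simp only [mem_filter, mem_compl] at hp
    simp [substOne, hp.2.2.2.1, hp.2.2.2.2]
  rw [h, graphPoly, map_prod]
  refine prod_dvd_prod_of_subset _ _ _ fun p hp ↦ ?_
  simp only [mem_filter] at hp ⊢
  exact ⟨hp.1, hp.2.1, hp.2.2.1⟩

/-- If a homogeneous polynomial contains the monomial `m`, then for some `S ⊆ Xs` substituting `1`
for the variables in `S` leaves a monomial of degree less than `m x` in each `x ∈ Xs \ S` and of
degree `m y` in each `y ∈ Ys`. -/
lemma exists_substOne_coeff_ne_zero {V : Type*} [Fintype V] [DecidableEq V]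
    {Xs Ys : Finset V} (hcover : Xs ∪ Ys = univ) (hdisj : Disjoint Xs Ys)
    {p : MvPolynomial V ℝ} {d : ℕ} (hp : p.IsHomogeneous d) {m : V →₀ ℕ} (hm : coeff m p ≠ 0) :
    ∃ S ⊆ Xs, ∃ n : V →₀ ℕ, coeff n (substOne S p) ≠ 0 ∧
      (∀ x ∈ Xs \ S, n x < m x) ∧ ∀ y ∈ Ys, n y = m y := by
  let u : (V →₀ ℕ) → ℝ := fun n ↦ ∏ y ∈ Ys, if n y = m y then 1 else 0
  let w : Finset V → (V →₀ ℕ) → ℝ := fun S n ↦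
    (∏ x ∈ Xs \ S, if n x < m x then -1 else 0) * u n
  have hsum : ∑ S ∈ Xs.powerset, monomialFunctional (w S) p = coeff m p := by
    simp only [monomialFunctional_apply]
    rw [sum_comm]
    have hw : ∀ n, ∑ S ∈ Xs.powerset, coeff n p * w S n =
        coeff n p * ((∏ x ∈ Xs, if n x < m x then 0 else 1) * u n) := by
      intro n
      rw [← mul_sum, ← sum_mul]
      congr 2
      have := prod_add (fun _ ↦ (1 : ℝ)) (fun x ↦ if n x < m x then (-1 : ℝ) else 0) Xs
      simp only [prod_const_one, one_mul] at this
      rw [← this]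
      refine prod_congr rfl fun x _ ↦ ?_
      split_ifs <;> norm_num
    simp only [hw]
    rw [sum_eq_single m]
    · simp [u]
    · intro n hn hne
      by_contra hcon
      apply hne
      have h2 := right_ne_zero_of_mul hcon
      have hx : ∀ x ∈ Xs, m x ≤ n x := fun x hx ↦ by
        have := prod_ne_zero_iff.1 (left_ne_zero_of_mul h2) x hx
        by_contra hlt
        simp [not_le.1 hlt] at this
      have hy : ∀ y ∈ Ys, n y = m y := fun y hy ↦ by
        have := prod_ne_zero_iff.1 (right_ne_zero_of_mul h2) y hy
        by_contra hlt
        simp [hlt] at this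
      have hle : m ≤ n := fun v ↦ by
        rcases mem_union.1 (hcover ▸ mem_univ v) with hv | hv
        · exact hx v hv
        · exact (hy v hv).ge
      have hdeg : n.degree = m.degree := by
        rw [Finsupp.degree_apply, Finsupp.degree_apply, ← hp.degree_eq_sum_deg_support hn,
          ← hp.degree_eq_sum_deg_support (mem_support_iff.2 hm)]
      obtain ⟨c, rfl⟩ := exists_add_of_le hle
      rw [map_add, add_eq_left, Finsupp.degree_eq_zero_iff] at hdeg
      rw [hdeg, add_zero]
    · intro hn
      exact absurd (mem_support_iff.2 hm) hn
  obtain ⟨S, hS, hne⟩ := exists_ne_zero_of_sum_ne_zero (hsum.trans_ne hm)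
  rw [mem_powerset] at hS
  have hinv : ∀ n : V →₀ ℕ, w S (n.filter (· ∉ S)) = w S n := by
    intro n
    simp only [w, u]
    congr 1
    · refine prod_congr rfl fun x hx ↦ ?_
      rw [Finsupp.filter_apply_pos (· ∉ S) _ (mem_sdiff.1 hx).2]
    · refine prod_congr rfl fun y hy ↦ ?_
      rw [Finsupp.filter_apply_pos (· ∉ S) _ fun hyS ↦ disjoint_left.1 hdisj (hS hyS) hy]
  rw [← monomialFunctional_substOne hinv, monomialFunctional_apply] at hne
  obtain ⟨n, hn, hne⟩ := exists_ne_zero_of_sum_ne_zero hne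
  refine ⟨S, hS, n, mem_support_iff.1 hn, fun x hx ↦ ?_, fun y hy ↦ ?_⟩
  · have := prod_ne_zero_iff.1 (left_ne_zero_of_mul (right_ne_zero_of_mul hne)) x hx
    by_contra hlt
    simp [hlt] at this
  · have := prod_ne_zero_iff.1 (right_ne_zero_of_mul (right_ne_zero_of_mul hne)) y hy
    by_contra hlt
    simp [hlt] at this

/-- The key lemma for paintability: let `V(G) = Xs ⊔ Ys` with `Xs` nonempty.  If
`P_G` has a monomial `m` with nonzero coefficient, then there is an independent set
`X' ⊆ Xs` such that `P_{G - X'}` (the graph polynomial of the subgraph induced on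
the complement of `X'`) has a monomial with nonzero coefficient whose degree in each
`x ∈ Xs \ X'` is at most `m x - 1` (in particular `m x ≥ 1` for such `x`) and whose
degree in each `y ∈ Ys` is at most `m y`. -/
theorem exists_indep_subset_graphPoly {V : Type*} [Fintype V] [LinearOrder V]
    (G : SimpleGraph V) [DecidableRel G.Adj]
    (Xs Ys : Finset V) (hcover : Xs ∪ Ys = univ) (hdisj : Disjoint Xs Ys)
    (hX : Xs.Nonempty)
    (m : V →₀ ℕ) (hm : MvPolynomial.coeff m (graphPoly G) ≠ 0) :
    ∃ X' ⊆ Xs, (∀ u ∈ X', ∀ v ∈ X', ¬ G.Adj u v) ∧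
      ∃ m' : V →₀ ℕ, MvPolynomial.coeff m' (graphPolyOn G X'ᶜ) ≠ 0 ∧
        (∀ x ∈ Xs \ X', m' x < m x) ∧ ∀ y ∈ Ys, m' y ≤ m y := by
  obtain ⟨S, hS, n, hn, hnX, hnY⟩ :=
    exists_substOne_coeff_ne_zero hcover hdisj (graphPoly_isHomogeneous G) hm
  refine ⟨S, hS, not_adj_of_substOne_graphPoly_ne_zero G fun h ↦ hn (by rw [h, coeff_zero]), ?_⟩
  obtain ⟨q, hq⟩ := graphPolyOn_dvd_substOne_graphPoly G S
  rw [hq] at hn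
  obtain ⟨m', hle, hm'⟩ := exists_le_coeff_ne_zero_of_coeff_mul_ne_zero hn
  exact ⟨m', hm', fun x hx ↦ (hle x).trans_lt (hnX x hx), fun y hy ↦ (hle y).trans (hnY y hy).le⟩
end

section
/- Let P ∈ ℝ[x₁,…,x_k,y₁,…,y_l] be a homogeneous polynomial (all monomials of P have the same total degree), and suppose the coefficient of the monomial x₁^{α₁}⋯x_k^{α_k} y₁^{β₁}⋯y_l^{β_l} in P is nonzero. Then there exists a subset J ⊆ {1,…,k} such that: (i) P has a monomial with nonzero coefficient whose degree in y_j equals β_j for every j and whose degree in x_i is at most α_i − 1 for every i ∉ J (the degrees in x_i for i ∈ J being unrestricted); and (ii) for all distinct a, b ∈ J, the linear polynomial x_a − x_b does not divide P. -/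
open MvPolynomial in
/-- A weighted sum of the coefficients of a multiple of `X a - X b` vanishes when the weight does
not distinguish the exponents of `X a * q` from those of `X b * q`. -/
theorem MvPolynomial.sum_coeff_mul_eq_zero_of_X_sub_X_dvd {σ R : Type*} [CommRing R]
    {a b : σ} {P : MvPolynomial σ R} (hP : (X a - X b) ∣ P) (w : (σ →₀ ℕ) → R)
    (hw : ∀ m, w (m + Finsupp.single a 1) = w (m + Finsupp.single b 1)) :
    ∑ m ∈ P.support, coeff m P * w m = 0 := by
  let L : MvPolynomial σ R →ₗ[R] R := (basisMonomials σ R).constr R w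
  have hL_monomial (m : σ →₀ ℕ) : L (monomial m 1) = w m := by
    simpa using (basisMonomials σ R).constr_basis R w m
  have hL : L P = ∑ m ∈ P.support, coeff m P * w m := by
    conv_lhs => rw [P.as_sum, map_sum]
    refine Finset.sum_congr rfl fun m _ => ?_
    rw [← mul_one (coeff m P), ← smul_eq_mul, ← smul_monomial, map_smul, hL_monomial]
    simp
  obtain ⟨Q, rfl⟩ := hP
  rw [← hL]
  have hcomp : L ∘ₗ LinearMap.mulLeft R (X a - X b) = 0 := by
    refine (basisMonomials σ R).ext fun m => ?_
    have hmul (c : σ) : X c * monomial m (1 : R) = monomial (m + Finsupp.single c 1) 1 := by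
      rw [X, monomial_mul, add_comm, one_mul]
    simp [sub_mul, hmul, hL_monomial, hw]
  exact LinearMap.congr_fun hcomp Q

open MvPolynomial in
/-- In a homogeneous polynomial, the monomial `d` is the only one whose exponent dominates `d`,
provided it occurs. -/
theorem MvPolynomial.IsHomogeneous.eq_of_le_of_coeff_ne_zero {σ R : Type*} [CommSemiring R]
    {P : MvPolynomial σ R} {n : ℕ} (hP : P.IsHomogeneous n) {d m : σ →₀ ℕ}
    (hd : coeff d P ≠ 0) (hm : coeff m P ≠ 0) (hle : d ≤ m) : m = d := by
  have hdeg : d.degree = m.degree := by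
    rw [Finsupp.degree_eq_weight_one]
    exact (hP hd).trans (hP hm).symm
  obtain ⟨e, rfl⟩ := exists_add_of_le hle
  rw [map_add, left_eq_add, Finsupp.degree_eq_zero_iff] at hdeg
  rw [hdeg, add_zero]


/-- Let `P ∈ ℝ[x₁,…,x_k, y₁,…,y_l]` be a homogeneous polynomial (all of its monomials
have the same total degree) in which the monomial `x₁^{α₁}⋯x_k^{α_k} y₁^{β₁}⋯y_l^{β_l}`
has nonzero coefficient.  Then there is a subset `J ⊆ {1,…,k}` such that:
(i) `P` has a monomial with nonzero coefficient whose degree in each `y_j` is exactly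
`β j` and whose degree in each `x_i` with `i ∉ J` is at most `α i - 1` (unrestricted
for `i ∈ J`); and (ii) for all distinct `a, b ∈ J` the linear polynomial `x_a - x_b`
does not divide `P`. -/
theorem exists_subset_of_homogeneous_coeff_ne_zero (k l : ℕ)
    (P : MvPolynomial (Fin k ⊕ Fin l) ℝ)
    (hhom : ∃ n, P.IsHomogeneous n)
    (α : Fin k → ℕ) (β : Fin l → ℕ)
    (hcoeff : MvPolynomial.coeff (Finsupp.equivFunOnFinite.symm (Sum.elim α β)) P ≠ 0) :
    ∃ J : Finset (Fin k),
      (∃ m : (Fin k ⊕ Fin l) →₀ ℕ, MvPolynomial.coeff m P ≠ 0 ∧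
        (∀ j : Fin l, m (Sum.inr j) = β j) ∧
        ∀ i : Fin k, i ∉ J → m (Sum.inl i) < α i) ∧
      ∀ a ∈ J, ∀ b ∈ J, a ≠ b →
        ¬ (MvPolynomial.X (Sum.inl a) - MvPolynomial.X (Sum.inl b)) ∣ P := by
  classical
  obtain ⟨n, hn⟩ := hhom
  set d := Finsupp.equivFunOnFinite.symm (Sum.elim α β)
  have hd_inl (i : Fin k) : d (Sum.inl i) = α i := rfl
  have hd_inr (j : Fin l) : d (Sum.inr j) = β j := rfl
  let w (J : Finset (Fin k)) (m : (Fin k ⊕ Fin l) →₀ ℕ) : ℝ :=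
    (if ∀ j, m (Sum.inr j) = β j then 1 else 0) *
      ∏ i ∈ Finset.univ \ J, -(if m (Sum.inl i) < α i then 1 else 0)
  have hw_sum (m : (Fin k ⊕ Fin l) →₀ ℕ) (hm : MvPolynomial.coeff m P ≠ 0) :
      ∑ J, w J m = if m = d then 1 else 0 := by
    have hprod := Finset.prod_add (fun _ => (1 : ℝ))
      (fun i => -(if m (Sum.inl i) < α i then 1 else 0)) Finset.univ
    simp only [Finset.prod_const_one, one_mul, Finset.powerset_univ] at hprod
    rw [← Finset.mul_sum, ← hprod]
    split_ifs with hy hmd hmd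
    · subst hmd
      simp [hd_inl]
    · obtain ⟨i, hi⟩ : ∃ i, m (Sum.inl i) < α i := by
        by_contra! hx
        refine hmd (hn.eq_of_le_of_coeff_ne_zero hcoeff hm ?_)
        rintro (i | j)
        · exact hx i
        · exact (hy j).ge
      rw [one_mul, Finset.prod_eq_zero (Finset.mem_univ i) (by simp [hi])]
    · subst hmd
      exact absurd hd_inr hy
    · rw [zero_mul]
  have hsum : ∑ J, ∑ m ∈ P.support, MvPolynomial.coeff m P * w J m
      = MvPolynomial.coeff d P := by
    rw [Finset.sum_comm]
    have hinner : ∀ m ∈ P.support, ∑ J, MvPolynomial.coeff m P * w J m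
        = if m = d then MvPolynomial.coeff m P else 0 := fun m hm => by
      rw [← Finset.mul_sum, hw_sum m (MvPolynomial.mem_support_iff.mp hm), mul_ite, mul_one,
        mul_zero]
    rw [Finset.sum_congr rfl hinner, Finset.sum_ite_eq',
      if_pos (MvPolynomial.mem_support_iff.mpr hcoeff)]
  obtain ⟨J, -, hJ⟩ := Finset.exists_ne_zero_of_sum_ne_zero (hsum.trans_ne hcoeff)
  refine ⟨J, ?_, fun a ha b hb _ hdvd => hJ ?_⟩
  · obtain ⟨m, -, hm⟩ := Finset.exists_ne_zero_of_sum_ne_zero hJ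
    obtain ⟨hy, hx⟩ := mul_ne_zero_iff.mp (right_ne_zero_of_mul hm)
    refine ⟨m, left_ne_zero_of_mul hm, by simpa using hy, fun i hi => ?_⟩
    simpa using Finset.prod_ne_zero_iff.mp hx i (by simpa using hi)
  · refine MvPolynomial.sum_coeff_mul_eq_zero_of_X_sub_X_dvd hdvd (w J) fun m => ?_
    have hout (c : Fin k) (hc : c ∈ J) (i : Fin k) (hi : i ∈ Finset.univ \ J) :
        (m + Finsupp.single (Sum.inl c) 1 : (Fin k ⊕ Fin l) →₀ ℕ) (Sum.inl i) = m (Sum.inl i) := by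
      have hci : c ≠ i := by
        rintro rfl
        exact (Finset.mem_sdiff.mp hi).2 hc
      simp [hci]
    have hw_shift (c : Fin k) (hc : c ∈ J) :
        w J (m + Finsupp.single (Sum.inl c) 1) = w J m := by
      refine congr_arg₂ (· * ·) (by simp) (Finset.prod_congr rfl fun i hi => ?_)
      rw [hout c hc i hi]
    rw [hw_shift a ha, hw_shift b hb]
end
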